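/- arXiv:2003.10616 — 10 statements merged into one kernel-verified Lean document; each statement's English description precedes it below -/
import Mathlib

section
/- Let L be a real linear functional on the space of real polynomials such that L((X·f)²) > 0 for every nonzero real polynomial f. Set a_0 := 0 and a_n := L(X^n) for n ≥ 1, and define the Hankel determinants P_n := -det((a_{i+j})_{i,j=0}^{n+1}) and Q_n := det((a_{i+j+2})_{i,j=0}^{n}). Then for every n ≥ 0: Q_n > 0, P_n/Q_n ≥ 0, P_n/Q_n ≤ P_{n+1}/Q_{n+1}, and moreover P_0/Q_0 = L(X)²/L(X²). -/
open Polynomial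

open Matrix in
/-- The Schur complement formula for a matrix bordered by a zero corner entry. -/
theorem Matrix.det_zero_bordered {n : ℕ} (H : Matrix (Fin n) (Fin n) ℝ) (hH : IsUnit H.det)
    (b : Fin n → ℝ) (M : Matrix (Fin (n + 1)) (Fin (n + 1)) ℝ) (h0 : M 0 0 = 0)
    (hr : ∀ i, M 0 i.succ = b i) (hc : ∀ i, M i.succ 0 = b i)
    (hs : ∀ i j, M i.succ j.succ = H i j) :
    M.det = -(H.det * (b ⬝ᵥ (H⁻¹ *ᵥ b))) := by
  let e : Fin (n + 1) ≃ Fin n ⊕ Unit := (finSuccEquiv n).trans (Equiv.optionEquivSumPUnit _)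
  let _ := H.invertibleOfIsUnitDet hH
  have hM : M.reindex e e =
      fromBlocks H (replicateCol Unit b) (replicateRow Unit b) (0 : Matrix Unit Unit ℝ) := by
    ext i j
    rcases i with i | i <;> rcases j with j | j <;> simp [e, h0, hr, hc, hs]
  rw [← det_reindex_self e M, hM, det_fromBlocks₁₁,
    det_unique (0 - replicateRow Unit b * ⅟H * replicateCol Unit b), invOf_eq_nonsing_inv,
    Matrix.mul_assoc, ← replicateCol_mulVec, zero_sub, ← mul_neg]
  rfl

open Matrix in
/-- The quadratic form of the inverse of a positive definite matrix does not increase when passing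
to a leading principal submatrix. -/
theorem Matrix.PosDef.dotProduct_inv_mulVec_castSucc_le {n : ℕ}
    {H : Matrix (Fin (n + 1)) (Fin (n + 1)) ℝ} (hH : H.PosDef) (b : Fin (n + 1) → ℝ) :
    (b ∘ Fin.castSucc) ⬝ᵥ ((H.submatrix Fin.castSucc Fin.castSucc)⁻¹ *ᵥ (b ∘ Fin.castSucc)) ≤
      b ⬝ᵥ (H⁻¹ *ᵥ b) := by
  set K := H.submatrix Fin.castSucc Fin.castSucc
  set c := b ∘ Fin.castSucc
  have hK : K.PosDef := hH.submatrix (Fin.castSucc_injective n)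
  set x := K⁻¹ *ᵥ c
  set y := H⁻¹ *ᵥ b
  have hx : K *ᵥ x = c := by
    simp [x, mulVec_mulVec, mul_nonsing_inv K hK.det_pos.ne'.isUnit]
  have hy : H *ᵥ y = b := by
    simp [y, mulVec_mulVec, mul_nonsing_inv H hH.det_pos.ne'.isUnit]
  let z : Fin (n + 1) → ℝ := Fin.snoc x 0
  have hzb : z ⬝ᵥ b = c ⬝ᵥ x := by
    simp [z, c, dotProduct, Fin.sum_univ_castSucc, mul_comm]
  have hzz : z ⬝ᵥ (H *ᵥ z) = c ⬝ᵥ x := by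
    rw [← hx, dotProduct_comm (K *ᵥ x)]
    simp [z, K, dotProduct, mulVec, Fin.sum_univ_castSucc]
  have hyz : y ⬝ᵥ (H *ᵥ z) = c ⬝ᵥ x := by
    have hT : Hᵀ = H := by simpa using hH.isHermitian.eq
    rw [dotProduct_mulVec, ← mulVec_transpose, hT, hy, dotProduct_comm, hzb]
  have h := hH.posSemidef.dotProduct_mulVec_nonneg (y - z)
  simp only [star_trivial, mulVec_sub, sub_dotProduct, dotProduct_sub, hy, hzb, hzz, hyz] at h
  rw [dotProduct_comm b y]
  linarith

/-- The shifted Hankel matrices of a functional positive on squares of multiples of `X` are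
positive definite. -/
theorem posDef_shifted_hankel (L : ℝ[X] →ₗ[ℝ] ℝ) (hL : ∀ f : ℝ[X], f ≠ 0 → 0 < L ((X * f) ^ 2))
    (n : ℕ) : (Matrix.of fun i j : Fin n => L (X ^ (i.val + j.val + 2))).PosDef := by
  refine Matrix.PosDef.of_dotProduct_mulVec_pos ?_ fun x hx => ?_
  · ext i j
    simp [add_comm]
  · let f : ℝ[X] := ∑ i : Fin n, x i • X ^ i.val
    have hf : f ≠ 0 := by
      obtain ⟨k, hk⟩ := Function.ne_iff.1 hx
      intro h
      apply hk
      have := congrArg (coeff · k.val) h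
      simpa [f, finsetSum_coeff, coeff_X_pow, Fin.val_inj] using this
    have hsq : (X * f) ^ 2 =
        ∑ i : Fin n, ∑ j : Fin n, (x i * x j) • (X : ℝ[X]) ^ (i.val + j.val + 2) := by
      rw [mul_pow, sq f, Finset.sum_mul_sum, Finset.mul_sum]
      refine Finset.sum_congr rfl fun i _ => ?_
      rw [Finset.mul_sum]
      refine Finset.sum_congr rfl fun j _ => ?_
      rw [smul_mul_smul_comm, mul_smul_comm]
      congr 1
      ring
    have h := hL f hf
    rw [hsq] at h
    refine h.trans_eq ?_
    simp only [dotProduct, Matrix.mulVec, Matrix.of_apply, Pi.star_apply, star_trivial, map_sum,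
      map_smul, smul_eq_mul, Finset.mul_sum]
    exact Finset.sum_congr rfl fun i _ => Finset.sum_congr rfl fun j _ => by ring


/-- **First part of the main theorem.** Let `L` be a real linear functional on real polynomials
with `L ((X * f)^2) > 0` for every nonzero real polynomial `f`. Set `a 0 := 0` and
`a n := L (X ^ n)` for `n ≥ 1`, and define the Hankel determinants
`P n := -det (a_{i+j})_{i,j=0}^{n+1}` and `Q n := det (a_{i+j+2})_{i,j=0}^{n}`.
Then for every `n`: `Q n > 0`, `P n / Q n ≥ 0`, `P n / Q n ≤ P (n+1) / Q (n+1)`, and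
`P 0 / Q 0 = L X ^ 2 / L (X ^ 2)`. -/
theorem stmt_1 (L : Polynomial ℝ →ₗ[ℝ] ℝ)
    (hL : ∀ f : Polynomial ℝ, f ≠ 0 → 0 < L ((X * f) ^ 2))
    (a : ℕ → ℝ) (ha0 : a 0 = 0) (ha : ∀ n : ℕ, 1 ≤ n → a n = L (X ^ n))
    (P Q : ℕ → ℝ)
    (hP : ∀ n : ℕ, P n = -Matrix.det (Matrix.of fun i j : Fin (n + 2) => a (i.val + j.val)))
    (hQ : ∀ n : ℕ, Q n = Matrix.det (Matrix.of fun i j : Fin (n + 1) => a (i.val + j.val + 2))) :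
    (∀ n : ℕ, 0 < Q n) ∧ (∀ n : ℕ, 0 ≤ P n / Q n) ∧
      (∀ n : ℕ, P n / Q n ≤ P (n + 1) / Q (n + 1)) ∧
      P 0 / Q 0 = (L X) ^ 2 / L (X ^ 2) := by
  let H (n : ℕ) : Matrix (Fin (n + 1)) (Fin (n + 1)) ℝ :=
    Matrix.of fun i j => a (i.val + j.val + 2)
  let b (n : ℕ) : Fin (n + 1) → ℝ := fun i => a (i.val + 1)
  have hH (n : ℕ) : (H n).PosDef := by
    convert posDef_shifted_hankel L hL (n + 1) using 1
    ext i j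
    exact ha _ (by omega)
  have hQpos (n : ℕ) : 0 < Q n := hQ n ▸ (hH n).det_pos
  have hPQ (n : ℕ) : P n / Q n = b n ⬝ᵥ ((H n)⁻¹.mulVec (b n)) := by
    rw [div_eq_iff (hQpos n).ne', hP,
      Matrix.det_zero_bordered (H n) (hH n).det_pos.ne'.isUnit (b n) _ (by simp [ha0])
        (by simp [b]) (by simp [b])
        (fun i j => congrArg a (by simp only [Fin.val_succ]; ring)), neg_neg, hQ, mul_comm]
  refine ⟨hQpos, fun n => ?_, fun n => ?_, ?_⟩
  · rw [hPQ]
    exact (hH n).inv.posSemidef.dotProduct_mulVec_nonneg (b n)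
  · rw [hPQ, hPQ]
    exact (hH (n + 1)).dotProduct_inv_mulVec_castSucc_le (b (n + 1))
  · rw [hP, hQ, Matrix.det_fin_two, Matrix.det_fin_one]
    simp [ha0, ha, sq]
end

section
/- Let a ∈ ℝ and let K : ℝ → ℝ be Lebesgue integrable on [a,∞) with K(y) > 0 for almost every y ∈ [a,∞), and suppose there exist ε > 0, M ≥ 0 and y₀ such that |K(y)| ≤ M·e^{-εy} for all y ≥ y₀. Let m ≥ 0 and let f : ℝ → ℝ be measurable with ∫_a^∞ f(y)² K(y) dy < ∞. If ∫_a^∞ f(y) y^n K(y) dy = 0 for every n ≥ m, then f(y) = 0 for almost every y ∈ [a,∞). -/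
open MeasureTheory Set Real

/-- Two finite measures on `ℝ` with the same moments agree, provided both have exponential
moments in a neighbourhood of `0`. -/
theorem MeasureTheory.Measure.ext_of_moments {μ ν : Measure ℝ} [IsFiniteMeasure μ]
    [IsFiniteMeasure ν] (hμ : 0 ∈ interior (ProbabilityTheory.integrableExpSet id μ))
    (hν : 0 ∈ interior (ProbabilityTheory.integrableExpSet id ν))
    (h : ∀ n : ℕ, ∫ x, x ^ n ∂μ = ∫ x, x ^ n ∂ν) : μ = ν := by
  set I := interior (ProbabilityTheory.integrableExpSet id μ) ∩
    interior (ProbabilityTheory.integrableExpSet id ν)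
  have hI : Convex ℝ I :=
    ProbabilityTheory.convex_integrableExpSet.interior.inter
      ProbabilityTheory.convex_integrableExpSet.interior
  have hU : IsPreconnected {z : ℂ | z.re ∈ I} := (hI.linear_preimage Complex.reLm).isPreconnected
  have hderiv : ∀ n : ℕ, iteratedDeriv n (ProbabilityTheory.complexMGF id μ) 0 =
      iteratedDeriv n (ProbabilityTheory.complexMGF id ν) 0 := fun n => by
    rw [ProbabilityTheory.iteratedDeriv_complexMGF (by simpa using hμ),
      ProbabilityTheory.iteratedDeriv_complexMGF (by simpa using hν)]
    simp only [id, zero_mul, Complex.exp_zero, mul_one, ← Complex.ofReal_pow,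
      integral_complex_ofReal, h n]
  have hev : ProbabilityTheory.complexMGF id μ =ᶠ[nhds 0] ProbabilityTheory.complexMGF id ν := by
    have h₁ := (ProbabilityTheory.analyticAt_complexMGF (X := id) (μ := μ) (z := 0)
      (by simpa using hμ)).hasFPowerSeriesAt
    have h₂ := (ProbabilityTheory.analyticAt_complexMGF (X := id) (μ := ν) (z := 0)
      (by simpa using hν)).hasFPowerSeriesAt
    simp only [hderiv] at h₁
    have h₃ := h₁.sub h₂
    rw [sub_self] at h₃
    filter_upwards [h₃.eventually_eq_zero] with z hz
    exact sub_eq_zero.mp hz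
  have heq : EqOn (ProbabilityTheory.complexMGF id μ) (ProbabilityTheory.complexMGF id ν)
      {z : ℂ | z.re ∈ I} :=
    (ProbabilityTheory.analyticOnNhd_complexMGF.mono fun z hz => hz.1)
      |>.eqOn_of_preconnected_of_eventuallyEq
      (ProbabilityTheory.analyticOnNhd_complexMGF.mono fun z hz => hz.2) hU
      (z₀ := 0) (by simpa using ⟨hμ, hν⟩) hev
  refine Measure.ext_of_charFun (funext fun t => ?_)
  rw [← ProbabilityTheory.complexMGF_id_mul_I, ← ProbabilityTheory.complexMGF_id_mul_I]
  exact heq (by simpa using ⟨hμ, hν⟩)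

theorem zero_mem_interior_integrableExpSet_withDensity {ν : Measure ℝ} {g : ℝ → ℝ} {δ : ℝ}
    (hδ : 0 < δ) (hg : AEMeasurable g ν)
    (hexp : Integrable (fun y => exp (δ * |y|) * g y) ν) :
    0 ∈ interior
      (ProbabilityTheory.integrableExpSet id (ν.withDensity fun y => ENNReal.ofReal (g y))) := by
  rw [mem_interior]
  refine ⟨Ioo (-δ) δ, fun t ht => ?_, isOpen_Ioo, by simpa using hδ⟩
  change Integrable (fun y : ℝ => exp (t * y)) _
  rw [integrable_withDensity_iff_integrable_smul₀' hg.ennreal_ofReal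
    (ae_of_all _ fun _ => ENNReal.ofReal_lt_top)]
  refine hexp.mono (by fun_prop) (ae_of_all _ fun y => ?_)
  have hty : t * y ≤ δ * |y| := (le_abs_self _).trans <| by
    rw [abs_mul]
    exact mul_le_mul_of_nonneg_right (abs_lt.mpr ht).le (abs_nonneg y)
  have hmax : |max (g y) 0| ≤ |g y| := by
    rw [abs_of_nonneg (le_max_right _ _)]
    exact max_le (le_abs_self _) (abs_nonneg _)
  simp only [ENNReal.toReal_ofReal', smul_eq_mul, norm_mul, norm_eq_abs, abs_exp]
  rw [mul_comm]
  gcongr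

/-- A function with exponentially decaying tails, all of whose moments vanish, is zero. -/
theorem ae_eq_zero_of_forall_integral_pow_mul_eq_zero {ν : Measure ℝ} {g : ℝ → ℝ} {δ : ℝ}
    (hδ : 0 < δ) (hg : Integrable g ν)
    (hexp : Integrable (fun y => exp (δ * |y|) * g y) ν)
    (hmom : ∀ n : ℕ, ∫ y, y ^ n * g y ∂ν = 0) : g =ᵐ[ν] 0 := by
  have hpos := zero_mem_interior_integrableExpSet_withDensity hδ hg.aemeasurable hexp
  have hneg := zero_mem_interior_integrableExpSet_withDensity (g := fun y => -g y) hδ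
    hg.aemeasurable.neg (by simpa using hexp.neg)
  have : IsFiniteMeasure (ν.withDensity fun y => ENNReal.ofReal (g y)) :=
    isFiniteMeasure_withDensity_ofReal hg.2
  have : IsFiniteMeasure (ν.withDensity fun y => ENNReal.ofReal (-g y)) :=
    isFiniteMeasure_withDensity_ofReal hg.neg.2
  have hlt (φ : ℝ → ℝ) : ∀ᵐ y ∂ν, ENNReal.ofReal (φ y) < ⊤ :=
    ae_of_all _ fun _ => ENNReal.ofReal_lt_top
  have hmeas := hg.aemeasurable.ennreal_ofReal
  have hmeas' : AEMeasurable (fun y => ENNReal.ofReal (-g y)) ν :=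
    hg.aemeasurable.neg.ennreal_ofReal
  have heq : (ν.withDensity fun y => ENNReal.ofReal (g y)) =
      ν.withDensity fun y => ENNReal.ofReal (-g y) := by
    refine Measure.ext_of_moments hpos hneg fun n => ?_
    have i₁ := ProbabilityTheory.integrable_pow_of_mem_interior_integrableExpSet hpos n
    have i₂ := ProbabilityTheory.integrable_pow_of_mem_interior_integrableExpSet hneg n
    rw [integrable_withDensity_iff_integrable_smul₀' hmeas (hlt _)] at i₁
    rw [integrable_withDensity_iff_integrable_smul₀' hmeas' (hlt _)] at i₂
    simp only [id] at i₁ i₂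
    rw [integral_withDensity_eq_integral_toReal_smul₀ hmeas (hlt _),
      integral_withDensity_eq_integral_toReal_smul₀ hmeas' (hlt _), ← sub_eq_zero,
      ← integral_sub i₁ i₂, ← hmom n]
    refine integral_congr_ae (ae_of_all _ fun y => ?_)
    simp only [ENNReal.toReal_ofReal', smul_eq_mul, ← sub_mul]
    rw [max_zero_sub_max_neg_zero_eq_self, mul_comm]
  rw [withDensity_eq_iff hmeas hmeas' hg.lintegral_lt_top.ne] at heq
  filter_upwards [heq] with y hy
  rcases le_total (g y) 0 with h | h
  · rw [ENNReal.ofReal_of_nonpos h, eq_comm, ENNReal.ofReal_eq_zero] at hy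
    simpa using le_antisymm h (by linarith)
  · rw [ENNReal.ofReal_of_nonpos (p := -g y) (by linarith), ENNReal.ofReal_eq_zero] at hy
    exact le_antisymm hy h

theorem integrableOn_exp_mul_abs_mul_of_exp_decay {a ε M y₀ c : ℝ} {K : ℝ → ℝ}
    (hK : IntegrableOn K (Ici a)) (hbound : ∀ y : ℝ, y₀ ≤ y → |K y| ≤ M * exp (-ε * y))
    (hc : c < ε) : IntegrableOn (fun y => exp (c * |y|) * K y) (Ici a) := by
  set b := max a (max y₀ 0)
  have hab : a ≤ b := le_max_left _ _
  have hcont : Continuous fun y : ℝ => exp (c * |y|) := by fun_prop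
  rw [← Icc_union_Ioi_eq_Ici hab]
  refine IntegrableOn.union ?_ ?_
  · exact (hK.mono_set Icc_subset_Ici_self).continuousOn_mul hcont.continuousOn isCompact_Icc
  · have hKb : IntegrableOn K (Ioi b) := hK.mono_set fun y hy => hab.trans (le_of_lt hy)
    refine ((integrableOn_exp_mul_Ioi (a := c - ε) (by linarith) b).const_mul M).mono'
      (hcont.aestronglyMeasurable.mul hKb.1) ?_
    filter_upwards [ae_restrict_mem measurableSet_Ioi] with y hy
    have hy₀ : y₀ ≤ y := ((le_max_left _ _).trans (le_max_right _ _)).trans (le_of_lt hy)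
    have hy0 : 0 ≤ y := ((le_max_right _ _).trans (le_max_right _ _)).trans (le_of_lt hy)
    rw [norm_mul, norm_eq_abs, norm_eq_abs, abs_exp, abs_of_nonneg hy0]
    calc exp (c * y) * |K y| ≤ exp (c * y) * (M * exp (-ε * y)) := by
          gcongr
          exact hbound y hy₀
      _ = M * exp ((c - ε) * y) := by
          rw [mul_left_comm, ← exp_add]
          ring_nf

/-- **Completeness of monomials in a weighted L² space on an unbounded interval.**
Let `K` be Lebesgue integrable on `[a, ∞)`, positive a.e. on `[a, ∞)`, with
`|K y| ≤ M · e^{-ε y}` for all `y ≥ y₀` (for some `ε > 0`, `M ≥ 0`). Let `m ≥ 0` and let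
`f` be measurable with `∫_a^∞ f(y)² K(y) dy < ∞`. If `∫_a^∞ f(y) yⁿ K(y) dy = 0` for every
`n ≥ m`, then `f = 0` a.e. on `[a, ∞)`. -/
theorem stmt_4 (a : ℝ) (K : ℝ → ℝ) (hK : IntegrableOn K (Ici a))
    (hKpos : ∀ᵐ y : ℝ, y ∈ Ici a → 0 < K y)
    (ε M y₀ : ℝ) (hε : 0 < ε) (hM : 0 ≤ M)
    (hbound : ∀ y : ℝ, y₀ ≤ y → |K y| ≤ M * Real.exp (-ε * y))
    (m : ℕ) (f : ℝ → ℝ) (hf : Measurable f)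
    (hfK : IntegrableOn (fun y : ℝ => f y ^ 2 * K y) (Ici a))
    (horth : ∀ n : ℕ, m ≤ n → ∫ y in Ici a, f y * y ^ n * K y = 0) :
    ∀ᵐ y : ℝ, y ∈ Ici a → f y = 0 := by
  set δ := ε / 6 with hδ_def
  have hδ : 0 < δ := by positivity
  set ν : Measure ℝ := volume.restrict (Ici a)
  have hKν : ∀ᵐ y ∂ν, 0 < K y := (ae_restrict_iff' measurableSet_Ici).mpr hKpos
  have hKm : AEStronglyMeasurable K ν := hK.1
  set C : ℝ := ((2 * m).factorial : ℝ) / δ ^ (2 * m)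
  have hdom : Integrable (fun y => f y ^ 2 * K y + C * (exp (3 * δ * |y|) * K y)) ν :=
    hfK.add ((integrableOn_exp_mul_abs_mul_of_exp_decay hK hbound
      (c := 3 * δ) (by linarith)).const_mul C)
  have hpow (y : ℝ) : (y ^ m) ^ 2 ≤ C * exp (δ * |y|) := by
    have h := pow_div_factorial_le_exp (x := δ * |y|) (by positivity) (2 * m)
    rw [div_le_iff₀ (by positivity), mul_pow, pow_mul |y|, sq_abs] at h
    rw [← pow_mul, mul_comm m, pow_mul, div_mul_eq_mul_div, le_div_iff₀ (by positivity)]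
    linarith
  have hamgm (y : ℝ) : exp (δ * |y|) * |f y * y ^ m| ≤ f y ^ 2 + C * exp (3 * δ * |y|) := by
    have h₁ : exp (3 * δ * |y|) = exp (δ * |y|) ^ 2 * exp (δ * |y|) := by
      rw [← exp_nat_mul, ← exp_add]
      push_cast
      ring_nf
    have h₂ := mul_le_mul_of_nonneg_left (hpow y) (sq_nonneg (exp (δ * |y|)))
    rw [h₁, abs_mul, ← sq_abs (f y)]
    rw [← sq_abs (y ^ m)] at h₂
    nlinarith [sq_nonneg (|f y| - exp (δ * |y|) * |y ^ m|), sq_nonneg (|f y|),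
      sq_nonneg (exp (δ * |y|) * |y ^ m|)]
  have hgm : AEStronglyMeasurable (fun y => f y * y ^ m * K y) ν :=
    (by fun_prop : AEStronglyMeasurable (fun y => f y * y ^ m) ν).mul hKm
  have hexp : Integrable (fun y => exp (δ * |y|) * (f y * y ^ m * K y)) ν := by
    refine hdom.mono' ((by fun_prop : AEStronglyMeasurable (fun y : ℝ => exp (δ * |y|)) ν).mul hgm)
      ?_
    filter_upwards [hKν] with y hy
    rw [norm_mul, norm_mul, norm_eq_abs, norm_eq_abs, norm_eq_abs, abs_exp, abs_of_pos hy]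
    nlinarith [mul_le_mul_of_nonneg_right (hamgm y) hy.le]
  have hg : Integrable (fun y => f y * y ^ m * K y) ν := by
    refine hexp.mono hgm (ae_of_all _ fun y => ?_)
    rw [norm_mul (exp _), norm_eq_abs (exp _), abs_exp]
    exact le_mul_of_one_le_left (norm_nonneg _) (one_le_exp (by positivity))
  have hzero := ae_eq_zero_of_forall_integral_pow_mul_eq_zero hδ hg hexp fun n => by
    rw [← horth (m + n) (Nat.le_add_right m n)]
    refine integral_congr_ae (ae_of_all _ fun y => ?_)
    ring
  refine (ae_restrict_iff' measurableSet_Ici).mp ?_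
  filter_upwards [hzero, hKν, ae_restrict_of_ae (Measure.ae_ne volume (0 : ℝ))] with y h₁ h₂ h₃
  simpa [h₂.ne', h₃] using h₁
end

section
/- Let a < b be reals and let K : ℝ → ℝ be Lebesgue integrable on [a,b] with K(y) > 0 for almost every y ∈ [a,b]. Let m ≥ 0 and let f : ℝ → ℝ be measurable with ∫_a^b f(y)² K(y) dy < ∞. If ∫_a^b f(y) y^n K(y) dy = 0 for every n ≥ m, then f(y) = 0 for almost every y ∈ [a,b]. -/
open MeasureTheory Set Real

/-- An integrable function on a bounded interval all of whose moments vanish is zero almost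
everywhere on that interval. -/
theorem ae_eq_zero_of_forall_integral_mul_pow_eq_zero {a b : ℝ} {g : ℝ → ℝ}
    (hg : IntegrableOn g (Icc a b)) (h : ∀ n : ℕ, ∫ y in Icc a b, y ^ n * g y = 0) :
    ∀ᵐ y : ℝ, y ∈ Icc a b → g y = 0 := by
  have hmul : ∀ φ : ℝ → ℝ, Continuous φ → IntegrableOn (fun y => φ y * g y) (Icc a b) :=
    fun φ hφ => hg.continuousOn_mul hφ.continuousOn isCompact_Icc
  have hpoly : ∀ p : Polynomial ℝ, ∫ y in Icc a b, p.eval y * g y = 0 := by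
    intro p
    induction p using Polynomial.induction_on' with
    | add p q hp hq =>
      simp_rw [Polynomial.eval_add, add_mul]
      rw [integral_add (hmul _ p.continuous) (hmul _ q.continuous), hp, hq, add_zero]
    | monomial n c =>
      simp_rw [Polynomial.eval_monomial, mul_assoc]
      rw [integral_const_mul, h, mul_zero]
  have hcont : ∀ φ : ℝ → ℝ, Continuous φ → ∫ y in Icc a b, φ y * g y = 0 := by
    intro φ hφ
    set C := ∫ y in Icc a b, ‖g y‖
    have hC : 0 ≤ C := integral_nonneg fun y => norm_nonneg (g y)
    have bound : ∀ ε > 0, ‖∫ y in Icc a b, φ y * g y‖ ≤ ε * C := by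
      intro ε hε
      obtain ⟨p, hp⟩ := exists_polynomial_near_of_continuousOn a b φ hφ.continuousOn ε hε
      have hsub : ∫ y in Icc a b, φ y * g y = ∫ y in Icc a b, (φ y - p.eval y) * g y := by
        simp_rw [sub_mul]
        rw [integral_sub (hmul _ hφ) (hmul _ p.continuous), hpoly, sub_zero]
      rw [hsub, ← integral_const_mul]
      refine norm_integral_le_of_norm_le (hg.norm.const_mul ε) ?_
      filter_upwards [ae_restrict_mem measurableSet_Icc] with y hy
      rw [norm_mul, Real.norm_eq_abs, abs_sub_comm]
      exact mul_le_mul_of_nonneg_right (hp y hy).le (norm_nonneg _)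
    refine norm_le_zero_iff.mp (le_of_forall_pos_le_add fun ε hε => ?_)
    calc ‖∫ y in Icc a b, φ y * g y‖ ≤ ε / (C + 1) * C := bound _ (by positivity)
      _ ≤ ε / (C + 1) * (C + 1) := by gcongr; linarith
      _ = 0 + ε := by field_simp; ring
  have hzero : ∀ᵐ y : ℝ, (Icc a b).indicator g y = 0 := by
    refine ae_eq_zero_of_integral_contDiff_smul_eq_zero
      (hg.integrable_indicator measurableSet_Icc).locallyIntegrable fun φ hφ _ => ?_
    rw [← hcont φ hφ.continuous, ← integral_indicator measurableSet_Icc]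
    simp_rw [smul_eq_mul, ← indicator_mul_right]
  filter_upwards [hzero] with y hy hmem
  rwa [indicator_of_mem hmem] at hy

/-- If a weight and its product with the square of a function are integrable, then so is its
product with the function itself. -/
theorem integrable_mul_of_integrable_sq_mul {α : Type*} [MeasurableSpace α] {μ : Measure α}
    {f K : α → ℝ} (hf : AEStronglyMeasurable f μ) (hK : Integrable K μ)
    (hfK : Integrable (fun y => f y ^ 2 * K y) μ) :
    Integrable (fun y => f y * K y) μ := by
  refine (hK.norm.add hfK.norm).mono' (hf.mul hK.aestronglyMeasurable)
    (Filter.Eventually.of_forall fun y => ?_)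
  have hsq : |f y| ≤ 1 + f y ^ 2 := by
    nlinarith [sq_nonneg (|f y| - 1), sq_abs (f y), abs_nonneg (f y)]
  simp only [Pi.add_apply, norm_mul, norm_pow, Real.norm_eq_abs, sq_abs]
  nlinarith [mul_le_mul_of_nonneg_right hsq (abs_nonneg (K y))]

/-- **Completeness of monomials in a weighted L² space on a bounded interval.**
Let `a < b`, let `K` be Lebesgue integrable on `[a, b]` and positive a.e. on `[a, b]`.
Let `m ≥ 0` and let `f` be measurable with `∫_a^b f(y)² K(y) dy < ∞`. If
`∫_a^b f(y) yⁿ K(y) dy = 0` for every `n ≥ m`, then `f = 0` a.e. on `[a, b]`. -/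
theorem stmt_5 (a b : ℝ) (hab : a < b) (K : ℝ → ℝ) (hK : IntegrableOn K (Icc a b))
    (hKpos : ∀ᵐ y : ℝ, y ∈ Icc a b → 0 < K y)
    (m : ℕ) (f : ℝ → ℝ) (hf : Measurable f)
    (hfK : IntegrableOn (fun y : ℝ => f y ^ 2 * K y) (Icc a b))
    (horth : ∀ n : ℕ, m ≤ n → ∫ y in Icc a b, f y * y ^ n * K y = 0) :
    ∀ᵐ y : ℝ, y ∈ Icc a b → f y = 0 := by
  have hg : IntegrableOn (fun y => y ^ m * (f y * K y)) (Icc a b) :=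
    IntegrableOn.continuousOn_mul (continuous_pow m).continuousOn
      (integrable_mul_of_integrable_sq_mul hf.aestronglyMeasurable hK hfK) isCompact_Icc
  have hzero := ae_eq_zero_of_forall_integral_mul_pow_eq_zero hg fun n => by
    rw [← horth (m + n) (Nat.le_add_right m n)]
    congr 1 with y
    ring
  filter_upwards [hzero, hKpos, Measure.ae_ne volume (0 : ℝ)] with y hy hKy hy0 hmem
  exact ((mul_eq_zero.mp ((mul_eq_zero.mp (hy hmem)).resolve_left
    (pow_ne_zero m hy0))).resolve_right (hKy hmem).ne')
end

section
/- Let g : ℝ → ℝ be Lebesgue integrable on [0,∞). If ∫_0^∞ g(y) e^{-s·y} dy = 0 for every real s > 0, then g(y) = 0 for almost every y ∈ [0,∞). -/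
open MeasureTheory Set Real

/-- If all Laplace integrals of `g` at positive reals vanish, then so do the integrals of
`g y * e^{-y}` against polynomials in `e^{-y}`. -/
theorem integral_mul_exp_mul_polynomial_eq_zero {g : ℝ → ℝ} (hg : IntegrableOn g (Ici 0))
    (hLap : ∀ s : ℝ, 0 < s → ∫ y in Ici (0 : ℝ), g y * Real.exp (-(s * y)) = 0)
    (p : Polynomial ℝ) :
    ∫ y in Ici (0 : ℝ), g y * Real.exp (-y) * p.eval (Real.exp (-y)) = 0 := by
  have hterm (n : ℕ) (y : ℝ) : g y * Real.exp (-y) * (p.coeff n * Real.exp (-y) ^ n) =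
      p.coeff n * (g y * Real.exp (-((n + 1 : ℝ) * y))) := by
    rw [← Real.exp_nat_mul, show -((n + 1 : ℝ) * y) = -y + n * -y by ring, Real.exp_add]
    ring
  simp_rw [Polynomial.eval_eq_sum_range, Finset.mul_sum, hterm]
  rw [integral_finsetSum]
  · refine Finset.sum_eq_zero fun n _ ↦ ?_
    rw [integral_const_mul, hLap _ (by positivity), mul_zero]
  · intro n _
    refine (Integrable.mul_bdd (c := 1) hg (by fun_prop) ?_).const_mul _
    filter_upwards [ae_restrict_mem measurableSet_Ici] with y hy
    have hy : 0 ≤ y := hy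
    rw [Real.norm_eq_abs, abs_of_pos (Real.exp_pos _), Real.exp_le_one_iff]
    have : 0 ≤ (n + 1 : ℝ) * y := by positivity
    linarith

/-- A continuous function with compact support in `(0, ∞)`, read in the variable `x = e^{-y}`,
is continuous. -/
theorem continuous_comp_neg_log {ψ : ℝ → ℝ} (hψ : Continuous ψ) (hc : HasCompactSupport ψ)
    (hs : tsupport ψ ⊆ Ioi 0) : Continuous fun x ↦ ψ (-Real.log x) := by
  rw [continuous_iff_continuousAt]
  intro x
  rcases eq_or_ne x 0 with rfl | hx
  · have h0 : ψ 0 = 0 := image_eq_zero_of_notMem_tsupport fun h ↦ lt_irrefl (0 : ℝ) (hs h)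
    have hlim : Filter.Tendsto (fun x ↦ -Real.log x) (nhdsWithin 0 {0}ᶜ) Filter.atTop :=
      Filter.tendsto_neg_atBot_atTop.comp Real.tendsto_log_nhdsNE_zero
    rw [continuousAt_iff_punctured_nhds, Real.log_zero, neg_zero, h0]
    have hψ0 : Filter.Tendsto ψ Filter.atTop (nhds 0) :=
      hc.is_zero_at_infty.mono_left atTop_le_cocompact
    exact hψ0.comp hlim
  · exact hψ.continuousAt.comp (Real.continuousAt_log hx).neg

/-- **Injectivity of the Laplace transform.** If `g` is Lebesgue integrable on `[0, ∞)` and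
`∫_0^∞ g(y) e^{-s y} dy = 0` for every real `s > 0`, then `g = 0` a.e. on `[0, ∞)`. -/
theorem stmt_6 (g : ℝ → ℝ) (hg : IntegrableOn g (Ici 0))
    (hLap : ∀ s : ℝ, 0 < s → ∫ y in Ici (0 : ℝ), g y * Real.exp (-(s * y)) = 0) :
    ∀ᵐ y : ℝ, y ∈ Ici (0 : ℝ) → g y = 0 := by
  have hbdd {u : ℝ → ℝ} (hu : Continuous u) : ∃ C, ∀ y ∈ Ici (0 : ℝ), ‖u (Real.exp (-y))‖ ≤ C := by
    obtain ⟨C, hC⟩ := (isCompact_Icc (a := (0 : ℝ)) (b := 1)).exists_bound_of_continuousOn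
      hu.continuousOn
    exact ⟨C, fun y hy ↦ hC _ ⟨(Real.exp_pos _).le, Real.exp_le_one_iff.2 (neg_nonpos.2 hy)⟩⟩
  have hint {f u : ℝ → ℝ} (hf : IntegrableOn f (Ici 0)) (hu : Continuous u) :
      IntegrableOn (fun y ↦ f y * u (Real.exp (-y))) (Ici 0) := by
    obtain ⟨C, hC⟩ := hbdd hu
    exact Integrable.mul_bdd (c := C) hf (by fun_prop)
      ((ae_restrict_mem measurableSet_Ici).mono hC)
  have hh : IntegrableOn (fun y ↦ g y * Real.exp (-y)) (Ici 0) := hint hg continuous_id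
  have hzero : ∀ᵐ y : ℝ, y ∈ Ioi (0 : ℝ) → g y * Real.exp (-y) = 0 := by
    refine isOpen_Ioi.ae_eq_zero_of_integral_contDiff_smul_eq_zero
      (hh.mono_set Ioi_subset_Ici_self).locallyIntegrableOn fun ψ hψ hc hs ↦ ?_
    have hφ := continuous_comp_neg_log hψ.continuous hc hs
    have hψφ : ∫ y, ψ y • (g y * Real.exp (-y)) =
        ∫ y in Ici (0 : ℝ), g y * Real.exp (-y) * ψ (-Real.log (Real.exp (-y))) := by
      rw [← setIntegral_eq_integral_of_forall_compl_eq_zero (s := Ici (0 : ℝ))]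
      · simp [mul_comm]
      · intro y hy
        rw [image_eq_zero_of_notMem_tsupport fun h ↦ hy (Ioi_subset_Ici_self (hs h)), zero_smul]
    rw [hψφ, ← norm_le_zero_iff]
    set M := ∫ y in Ici (0 : ℝ), ‖g y * Real.exp (-y)‖
    have hM0 : 0 ≤ M := integral_nonneg fun _ ↦ norm_nonneg _
    refine le_of_forall_pos_le_add fun ε hε ↦ ?_
    obtain ⟨p, hp⟩ := exists_polynomial_near_of_continuousOn 0 1 _ hφ.continuousOn
      (ε / (M + 1)) (by positivity)
    have hsub := integral_sub (hint hh hφ) (hint hh p.continuous)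
    rw [integral_mul_exp_mul_polynomial_eq_zero hg hLap p, sub_zero] at hsub
    rw [← hsub]
    calc _ ≤ ∫ y in Ici (0 : ℝ), ‖g y * Real.exp (-y)‖ * (ε / (M + 1)) := by
          refine norm_integral_le_of_norm_le (hh.norm.mul_const _) ?_
          filter_upwards [ae_restrict_mem measurableSet_Ici] with y hy
          rw [← mul_sub, norm_mul, norm_sub_rev]
          gcongr
          exact (hp _ ⟨(Real.exp_pos _).le, Real.exp_le_one_iff.2 (neg_nonpos.2 hy)⟩).le
      _ = M * (ε / (M + 1)) := integral_mul_const _ _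
      _ ≤ 0 + ε := by
          rw [zero_add, mul_div_assoc', div_le_iff₀ (by positivity)]
          nlinarith
  filter_upwards [hzero, Measure.ae_ne volume (0 : ℝ)] with y hy hy0 hmem
  exact (mul_eq_zero.1 (hy (lt_of_le_of_ne hmem hy0.symm))).resolve_right (Real.exp_ne_zero _)
end

section
/- The Lebesgue integral ∫_0^1 (1/(1−x) + 1/log x) dx equals the Euler–Mascheroni constant γ. -/
open MeasureTheory Set Real

lemma integrable_rpow_Ioo_prod_Ioc (k : ℕ) :
    Integrable (fun p : ℝ × ℝ => p.1 ^ p.2)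
      ((volume.restrict (Ioo (0 : ℝ) 1)).prod (volume.restrict (Ioc (k : ℝ) (k + 1)))) := by
  refine Integrable.of_bound (Measurable.aestronglyMeasurable (by fun_prop)) 1 ?_
  rw [Measure.prod_restrict]
  refine (ae_restrict_iff' (measurableSet_Ioo.prod measurableSet_Ioc)).2 (.of_forall ?_)
  rintro ⟨x, t⟩ ⟨hx, ht⟩
  rw [Real.norm_of_nonneg (rpow_nonneg hx.1.le _)]
  exact rpow_le_one hx.1.le hx.2.le ((Nat.cast_nonneg k).trans ht.1.le)

lemma integral_Ioc_rpow_exponent {x : ℝ} (hx : x ∈ Ioo (0 : ℝ) 1) (k : ℕ) :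
    ∫ t in Ioc (k : ℝ) (k + 1), x ^ t = x ^ k * ((x - 1) / log x) := by
  have hlog : log x ≠ 0 := (log_neg hx.1 hx.2).ne
  have hderiv (t : ℝ) : HasDerivAt (fun t : ℝ => x ^ t / log x) (x ^ t) t := by
    simpa [hlog] using ((hasStrictDerivAt_const_rpow hx.1 t).hasDerivAt.div_const (log x))
  have hcont : Continuous fun t : ℝ => x ^ t := continuous_const_rpow hx.1.ne'
  rw [← intervalIntegral.integral_of_le (by linarith),
    intervalIntegral.integral_eq_sub_of_hasDerivAt (fun t _ => hderiv t)
      (hcont.intervalIntegrable _ _), rpow_add hx.1, rpow_one, rpow_natCast]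
  ring

lemma integral_Ioo_rpow {t : ℝ} (ht : 0 ≤ t) :
    ∫ x in Ioo (0 : ℝ) 1, x ^ t = 1 / (t + 1) := by
  rw [← integral_Ioc_eq_integral_Ioo, ← intervalIntegral.integral_of_le zero_le_one,
    integral_rpow (Or.inl (by linarith)), one_rpow, zero_rpow (by linarith), sub_zero]

lemma integrableOn_pow_mul_sub_one_div_log (k : ℕ) :
    IntegrableOn (fun x : ℝ => x ^ k * ((x - 1) / log x)) (Ioo 0 1) :=
  IntegrableOn.congr_fun (integrable_rpow_Ioo_prod_Ioc k).integral_prod_left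
    (fun _ hx => integral_Ioc_rpow_exponent hx k) measurableSet_Ioo

lemma integral_pow_mul_sub_one_div_log (k : ℕ) :
    ∫ x in Ioo (0 : ℝ) 1, x ^ k * ((x - 1) / log x) = log (k + 2) - log (k + 1) := by
  have hk : (0 : ℝ) ≤ k := Nat.cast_nonneg k
  rw [← setIntegral_congr_fun measurableSet_Ioo
      (fun x hx => integral_Ioc_rpow_exponent hx k),
    integral_integral_swap (f := fun x t : ℝ => x ^ t) (integrable_rpow_Ioo_prod_Ioc k),
    setIntegral_congr_fun measurableSet_Ioc
      (fun t ht => integral_Ioo_rpow (hk.trans ht.1.le)),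
    ← intervalIntegral.integral_of_le (by linarith),
    intervalIntegral.integral_comp_add_right (fun t : ℝ => 1 / t),
    integral_one_div_of_pos (by linarith) (by linarith), log_div (by linarith) (by linarith)]
  ring_nf

lemma integrableOn_pow_Ioo (k : ℕ) : IntegrableOn (fun x : ℝ => x ^ k) (Ioo 0 1) :=
  (continuous_pow k).integrableOn_Icc.mono_set Ioo_subset_Icc_self

lemma integral_pow_mul_one_sub (k : ℕ) :
    ∫ x in Ioo (0 : ℝ) 1, x ^ k * (1 - (x - 1) / log x) =
      1 / ((k : ℝ) + 1) - (log (k + 2) - log (k + 1)) := by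
  simp_rw [mul_sub, mul_one]
  rw [integral_sub (integrableOn_pow_Ioo k) (integrableOn_pow_mul_sub_one_div_log k),
    integral_pow_mul_sub_one_div_log]
  simpa using integral_Ioo_rpow (Nat.cast_nonneg k)

lemma one_sub_sub_one_div_log_nonneg {x : ℝ} (hx : x ∈ Ioo (0 : ℝ) 1) :
    0 ≤ 1 - (x - 1) / log x := by
  rw [sub_nonneg, div_le_one_of_neg (log_neg hx.1 hx.2)]
  exact log_le_sub_one_of_pos hx.1

lemma sum_range_eq_eulerMascheroniSeq (n : ℕ) :
    ∑ k ∈ Finset.range n, (1 / ((k : ℝ) + 1) - (log (k + 2) - log (k + 1))) =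
      eulerMascheroniSeq n := by
  induction n with
  | zero => simp [eulerMascheroniSeq_zero]
  | succ n ih =>
    rw [Finset.sum_range_succ, ih, eulerMascheroniSeq, eulerMascheroniSeq, harmonic_succ]
    push_cast
    rw [add_assoc (n : ℝ) 1 1, one_add_one_eq_two]
    ring

/-- The Lebesgue integral `∫_0^1 (1/(1-x) + 1/log x) dx` equals the Euler–Mascheroni
constant `γ`. -/
theorem stmt_7 :
    ∫ x in Ioo (0 : ℝ) 1, (1 / (1 - x) + 1 / Real.log x) =
      Real.eulerMascheroniConstant := by
  set F : ℕ → ℝ → ℝ := fun k x => x ^ k * (1 - (x - 1) / log x) with hF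
  have hFint (k : ℕ) : IntegrableOn (F k) (Ioo 0 1) := by
    simp only [hF, mul_sub, mul_one]
    exact (integrableOn_pow_Ioo k).sub (integrableOn_pow_mul_sub_one_div_log k)
  have hFnonneg (k : ℕ) {x : ℝ} (hx : x ∈ Ioo (0 : ℝ) 1) : 0 ≤ F k x :=
    mul_nonneg (pow_nonneg hx.1.le k) (one_sub_sub_one_div_log_nonneg hx)
  have hsum : HasSum (fun k => ∫ x in Ioo (0 : ℝ) 1, F k x) eulerMascheroniConstant := by
    rw [hasSum_iff_tendsto_nat_of_nonneg
      fun k => setIntegral_nonneg measurableSet_Ioo fun x hx => hFnonneg k hx]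
    simp_rw [hF, integral_pow_mul_one_sub, sum_range_eq_eulerMascheroniSeq]
    exact tendsto_eulerMascheroniSeq
  have hnorm : Summable fun k => ∫ x in Ioo (0 : ℝ) 1, ‖F k x‖ := by
    convert hsum.summable using 2 with k
    exact setIntegral_congr_fun measurableSet_Ioo
      fun x hx => Real.norm_of_nonneg (hFnonneg k hx)
  rw [← (hasSum_integral_of_summable_integral_norm hFint hnorm).unique hsum]
  refine setIntegral_congr_fun measurableSet_Ioo fun x hx => ?_
  have hlog : log x ≠ 0 := (log_neg hx.1 hx.2).ne
  have hx1 : 1 - x ≠ 0 := (sub_pos.2 hx.2).ne'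
  simp only [hF]
  rw [tsum_mul_right, tsum_geometric_of_lt_one hx.1.le hx.2]
  field_simp
  ring
end

section
/- For every integer n ≥ 1, ∫_0^1 ( x^{n-1}·(log(1−x))^n + x^n·(log(1−x))^{n-1} ) dx = (−1)^n · (n−1)! · Σ_{i=0}^{n} C(n,i)·(−1)^i·(n−2i−1)/(i+1)^{n+1}. -/
open MeasureTheory Set Real

lemma image_exp_neg_Ioi_zero : (fun t : ℝ => Real.exp (-t)) '' Ioi 0 = Ioo 0 1 := by
  ext y
  constructor
  · rintro ⟨t, ht, rfl⟩
    exact ⟨Real.exp_pos _, Real.exp_lt_one_iff.mpr (neg_lt_zero.mpr ht)⟩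
  · rintro ⟨h0, h1⟩
    exact ⟨-Real.log y, neg_pos.mpr (Real.log_neg h0 h1), by simp [Real.exp_log h0]⟩

lemma integral_pow_mul_log_pow (i k : ℕ) :
    ∫ y in Ioo (0 : ℝ) 1, y ^ i * Real.log y ^ k =
      (-1) ^ k * (k.factorial : ℝ) / ((i : ℝ) + 1) ^ (k + 1) := by
  have hderiv : ∀ t ∈ Ioi (0 : ℝ),
      HasDerivWithinAt (fun t : ℝ => Real.exp (-t)) (-Real.exp (-t)) (Ioi 0) t := fun t _ => by
    simpa using ((hasDerivAt_id t).neg.exp).hasDerivWithinAt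
  have hinj : InjOn (fun t : ℝ => Real.exp (-t)) (Ioi 0) := fun a _ b _ h => by
    simpa using h
  have hgamma := Real.integral_rpow_mul_exp_neg_mul_Ioi (a := (k : ℝ) + 1) (r := (i : ℝ) + 1)
    (by positivity) (by positivity)
  rw [← image_exp_neg_Ioi_zero,
    integral_image_eq_integral_abs_deriv_smul measurableSet_Ioi hderiv hinj]
  have hcongr : ∀ t ∈ Ioi (0 : ℝ),
      |-Real.exp (-t)| • (Real.exp (-t) ^ i * Real.log (Real.exp (-t)) ^ k) =
        (-1) ^ k * (t ^ ((k : ℝ) + 1 - 1) * Real.exp (-(((i : ℝ) + 1) * t))) := fun t _ => by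
    have hexp : Real.exp (-(((i : ℝ) + 1) * t)) = Real.exp (-t) ^ i * Real.exp (-t) := by
      rw [← Real.exp_nat_mul, ← Real.exp_add]
      ring_nf
    rw [add_sub_cancel_right, Real.rpow_natCast, hexp, abs_neg, abs_of_pos (Real.exp_pos _),
      Real.log_exp, neg_pow t k, smul_eq_mul]
    ring
  rw [setIntegral_congr_fun measurableSet_Ioi hcongr, integral_const_mul, hgamma,
    Real.Gamma_nat_eq_factorial]
  have hpow : (1 / ((i : ℝ) + 1)) ^ ((k : ℝ) + 1) = 1 / ((i : ℝ) + 1) ^ (k + 1) := by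
    rw [← Nat.cast_add_one k, Real.rpow_natCast, one_div_pow]
  rw [hpow]
  ring

lemma integrableOn_pow_mul_log_pow (i k : ℕ) :
    IntegrableOn (fun y : ℝ => y ^ i * Real.log y ^ k) (Ioo 0 1) := by
  refine Integrable.of_integral_ne_zero ?_
  rw [integral_pow_mul_log_pow]
  have : (k.factorial : ℝ) ≠ 0 := by positivity
  have : (i : ℝ) + 1 ≠ 0 := by positivity
  positivity

lemma one_sub_pow_mul_eq_sum (a : ℕ) (y z : ℝ) :
    (1 - y) ^ a * z = ∑ i ∈ Finset.range (a + 1), (a.choose i : ℝ) * (-1) ^ i * (y ^ i * z) := by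
  rw [sub_eq_neg_add, add_pow, Finset.sum_mul]
  refine Finset.sum_congr rfl fun i _ => ?_
  rw [neg_pow y i]
  ring

lemma integrableOn_one_sub_pow_mul_log_pow (a k : ℕ) :
    IntegrableOn (fun y : ℝ => (1 - y) ^ a * Real.log y ^ k) (Ioo 0 1) := by
  simp_rw [one_sub_pow_mul_eq_sum]
  exact integrable_finsetSum _ fun i _ => (integrableOn_pow_mul_log_pow i k).const_mul _

lemma integral_one_sub_pow_mul_log_pow (a k : ℕ) :
    ∫ y in Ioo (0 : ℝ) 1, (1 - y) ^ a * Real.log y ^ k =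
      (-1) ^ k * (k.factorial : ℝ) *
        ∑ i ∈ Finset.range (a + 1), (a.choose i : ℝ) * (-1) ^ i / ((i : ℝ) + 1) ^ (k + 1) := by
  simp_rw [one_sub_pow_mul_eq_sum]
  rw [integral_finsetSum _ fun i _ => (integrableOn_pow_mul_log_pow i k).const_mul _,
    Finset.mul_sum]
  refine Finset.sum_congr rfl fun i _ => ?_
  rw [integral_const_mul, integral_pow_mul_log_pow]
  ring

lemma setIntegral_Ioo_zero_one_comp_one_sub (f : ℝ → ℝ) :
    ∫ x in Ioo (0 : ℝ) 1, f (1 - x) = ∫ x in Ioo (0 : ℝ) 1, f x := by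
  rw [← integral_Ioc_eq_integral_Ioo, ← integral_Ioc_eq_integral_Ioo,
    ← intervalIntegral.integral_of_le zero_le_one, ← intervalIntegral.integral_of_le zero_le_one,
    intervalIntegral.integral_comp_sub_left]
  simp

/-- For every integer `n ≥ 1`,
`∫_0^1 (x^{n-1} (log(1-x))^n + x^n (log(1-x))^{n-1}) dx
  = (-1)^n (n-1)! Σ_{i=0}^{n} C(n,i) (-1)^i (n-2i-1)/(i+1)^{n+1}`. -/
theorem stmt_8 (n : ℕ) (hn : 1 ≤ n) :
    ∫ x in Ioo (0 : ℝ) 1,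
        (x ^ (n - 1) * (Real.log (1 - x)) ^ n + x ^ n * (Real.log (1 - x)) ^ (n - 1)) =
      (-1 : ℝ) ^ n * (Nat.factorial (n - 1) : ℝ) *
        ∑ i ∈ Finset.range (n + 1),
          (n.choose i : ℝ) * (-1 : ℝ) ^ i * ((n : ℝ) - 2 * i - 1) / ((i : ℝ) + 1) ^ (n + 1) := by
  obtain ⟨m, rfl⟩ : ∃ m, n = m + 1 := ⟨n - 1, by omega⟩
  rw [Nat.add_sub_cancel]
  have hrefl := setIntegral_Ioo_zero_one_comp_one_sub fun y =>
    (1 - y) ^ m * Real.log y ^ (m + 1) + (1 - y) ^ (m + 1) * Real.log y ^ m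
  simp only [sub_sub_cancel] at hrefl
  rw [hrefl, integral_add (integrableOn_one_sub_pow_mul_log_pow m (m + 1))
    (integrableOn_one_sub_pow_mul_log_pow (m + 1) m), integral_one_sub_pow_mul_log_pow,
    integral_one_sub_pow_mul_log_pow]
  have hext : ∑ i ∈ Finset.range (m + 1),
      (m.choose i : ℝ) * (-1) ^ i / ((i : ℝ) + 1) ^ (m + 1 + 1) =
      ∑ i ∈ Finset.range (m + 1 + 1),
        (m.choose i : ℝ) * (-1) ^ i / ((i : ℝ) + 1) ^ (m + 1 + 1) := by
    simp [Finset.sum_range_succ _ (m + 1)]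
  rw [hext, Finset.mul_sum, Finset.mul_sum, Finset.mul_sum, ← Finset.sum_add_distrib]
  refine Finset.sum_congr rfl fun i hi => ?_
  have hi' : i ≤ m + 1 := by simpa [Nat.lt_succ_iff] using hi
  have hchoose : (m.choose i : ℝ) * (m + 1) = ((m + 1).choose i : ℝ) * (m + 1 - i) := by
    have h := Nat.choose_mul_succ_eq m i
    rw [← @Nat.cast_inj ℝ] at h
    push_cast [Nat.cast_sub hi'] at h
    exact h
  have hpos : (i : ℝ) + 1 ≠ 0 := by positivity
  rw [Nat.factorial_succ]
  push_cast
  field_simp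
  linear_combination (-(-1 : ℝ) ^ m * ((i : ℝ) + 1) ^ (m + 1)) * hchoose
end

section
/- Set a_0 := 0 and, for n ≥ 1, a_n := (n−1)! · Σ_{i=0}^{n} C(n,i)·(−1)^i·(n−2i−1)/(i+1)^{n+1}, and define the Hankel determinants P_n := -det((a_{i+j})_{i,j=0}^{n+1}) and Q_n := det((a_{i+j+2})_{i,j=0}^{n}). Then for every n ≥ 0: Q_n > 0, 0 < P_n/Q_n < γ, P_n/Q_n ≤ P_{n+1}/Q_{n+1}, and lim_{n→∞} P_n/Q_n = γ, where γ is the Euler–Mascheroni constant. -/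
open Filter

section
open MeasureTheory Set Real

/-- The change of variables `u t = t (1 - e^{-t})`. -/
noncomputable def gammaNode (t : ℝ) : ℝ := t * (1 - exp (-t))

/-- The weight `e^{-t} (1 / (1 - e^{-t}) - 1 / t)`, whose integral over `(0, ∞)` is `γ`. -/
noncomputable def gammaWeight (t : ℝ) : ℝ := exp (-t) * (1 / (1 - exp (-t)) - 1 / t)

lemma one_sub_exp_neg_pos {t : ℝ} (ht : 0 < t) : 0 < 1 - exp (-t) := by
  have : exp (-t) < 1 := by simpa using ht
  linarith

lemma gammaNode_pos {t : ℝ} (ht : 0 < t) : 0 < gammaNode t :=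
  mul_pos ht (one_sub_exp_neg_pos ht)

lemma gammaNode_le {t : ℝ} (ht : 0 < t) : gammaNode t ≤ t := by
  have := exp_pos (-t)
  unfold gammaNode
  nlinarith

lemma strictMonoOn_gammaNode : StrictMonoOn gammaNode (Ioi 0) := by
  intro s hs t ht hst
  have h : exp (-t) < exp (-s) := exp_lt_exp.2 (by linarith)
  have := one_sub_exp_neg_pos hs
  simp only [mem_Ioi] at hs ht
  unfold gammaNode
  nlinarith

lemma gammaWeight_pos {t : ℝ} (ht : 0 < t) : 0 < gammaWeight t := by
  have h1 := one_sub_exp_neg_pos ht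
  have h2 := add_one_lt_exp (neg_ne_zero.2 ht.ne')
  refine mul_pos (exp_pos _) (sub_pos.2 ?_)
  exact one_div_lt_one_div_of_lt h1 (by linarith)

lemma one_div_one_sub_exp_neg_sub_le {t : ℝ} (ht : 0 < t) :
    1 / (1 - exp (-t)) - 1 / t ≤ 1 := by
  have h1 := one_sub_exp_neg_pos ht
  have h2 := add_one_le_exp t
  have h3 : exp (-t) * exp t = 1 := by rw [← exp_add]; simp
  have h4 := exp_pos (-t)
  rw [sub_le_iff_le_add, div_le_iff₀ h1]
  field_simp
  nlinarith

lemma gammaWeight_le {t : ℝ} (ht : 0 < t) : gammaWeight t ≤ exp (-t) :=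
  mul_le_of_le_one_right (exp_pos _).le (one_div_one_sub_exp_neg_sub_le ht)

lemma measurable_gammaNode : Measurable gammaNode := by unfold gammaNode; fun_prop

lemma measurable_gammaWeight : Measurable gammaWeight := by unfold gammaWeight; fun_prop

lemma integrableOn_pow_mul_exp_neg_mul (k : ℕ) {r : ℝ} (hr : 0 < r) :
    IntegrableOn (fun t : ℝ => t ^ k * exp (-(r * t))) (Ioi 0) := by
  have := integrableOn_rpow_mul_exp_neg_mul_rpow (p := 1) (s := k) (b := r)
    (by have : (0 : ℝ) ≤ k := k.cast_nonneg
        linarith) (by norm_num) hr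
  simpa using this

lemma integral_pow_mul_exp_neg_mul (k : ℕ) {r : ℝ} (hr : 0 < r) :
    ∫ t in Ioi 0, t ^ k * exp (-(r * t)) = k.factorial / r ^ (k + 1) := by
  have := integral_rpow_mul_exp_neg_mul_Ioi (a := (k : ℝ) + 1) (r := r) (by positivity) hr
  rw [Real.Gamma_nat_eq_factorial] at this
  simp only [add_sub_cancel_right, rpow_natCast] at this
  rw [this]
  norm_cast
  rw [one_div, inv_pow]
  field_simp

lemma integrableOn_of_le_pow_mul_exp {f : ℝ → ℝ} (hf : Measurable f) (C : ℝ) (k : ℕ) {r : ℝ}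
    (hr : 0 < r) (h : ∀ t, 0 < t → |f t| ≤ C * (t ^ k * exp (-(r * t)))) :
    IntegrableOn f (Ioi 0) := by
  refine Integrable.mono' ((integrableOn_pow_mul_exp_neg_mul k hr).const_mul C)
    hf.aestronglyMeasurable ?_
  filter_upwards [ae_restrict_mem measurableSet_Ioi] with t ht
  exact h t ht

/-- The `n`-th moment of the pushforward of `gammaWeight` under `gammaNode`. -/
noncomputable def gammaMoment (n : ℕ) : ℝ := ∫ t in Ioi 0, gammaNode t ^ n * gammaWeight t

lemma integrableOn_gammaNode_pow_mul (n : ℕ) :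
    IntegrableOn (fun t => gammaNode t ^ n * gammaWeight t) (Ioi 0) := by
  refine integrableOn_of_le_pow_mul_exp
    ((measurable_gammaNode.pow_const n).mul measurable_gammaWeight) 1 n one_pos fun t ht => ?_
  have h1 := gammaNode_pos ht
  have h2 := gammaWeight_pos ht
  rw [abs_of_pos (by positivity), one_mul, one_mul]
  gcongr
  · exact gammaNode_le ht
  · exact gammaWeight_le ht

lemma integral_exp_neg_mul_sub_exp_neg_mul_div {a b : ℝ} (ha : 0 < a) (hab : a ≤ b) :
    IntegrableOn (fun t => (exp (-(a * t)) - exp (-(b * t))) / t) (Ioi 0) ∧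
    ∫ t in Ioi 0, (exp (-(a * t)) - exp (-(b * t))) / t = log (b / a) := by
  have hint : IntegrableOn (fun t => (exp (-(a * t)) - exp (-(b * t))) / t) (Ioi 0) := by
    refine integrableOn_of_le_pow_mul_exp (by fun_prop) (b - a) 0 ha fun t ht => ?_
    have h1 : exp (-(b * t)) ≤ exp (-(a * t)) := exp_le_exp.2 (by nlinarith)
    have h2 : exp (-(b * t)) = exp (-(a * t)) * exp (-((b - a) * t)) := by
      rw [← exp_add]; congr 1; ring
    have h3 := add_one_le_exp (-((b - a) * t))
    have h4 := exp_pos (-(a * t))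
    rw [abs_of_nonneg (div_nonneg (by linarith) ht.le), div_le_iff₀ ht]
    rw [h2]
    simp only [pow_zero, one_mul]
    nlinarith
  refine ⟨hint, ?_⟩
  have := Frullani.integral_Ioi_eq (f := fun t : ℝ => exp (-t)) (L := 1) (R := 0) (a := a) (b := b)
    ((Continuous.locallyIntegrable (f := fun t : ℝ => exp (-t)) (by fun_prop)).locallyIntegrableOn _) ha (ha.trans_le hab)
    (by
      have : Tendsto (fun t : ℝ => exp (-t)) (nhds 0) (nhds (exp (-0))) :=
        Continuous.tendsto (by fun_prop) 0
      simpa using this.mono_left nhdsWithin_le_nhds)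
    (tendsto_exp_neg_atTop_nhds_zero)
    (by simpa [div_eq_inv_mul] using hint)
  simpa [div_eq_inv_mul] using this

lemma integral_gammaWeight_mul_one_sub_exp_pow (n : ℕ) :
    ∫ t in Ioi 0, gammaWeight t * (1 - exp (-t) ^ n) = eulerMascheroniSeq n := by
  have hint (n : ℕ) : IntegrableOn (fun t => gammaWeight t * (1 - exp (-t) ^ n)) (Ioi 0) := by
    refine integrableOn_of_le_pow_mul_exp
      (measurable_gammaWeight.mul (by fun_prop)) 1 0 one_pos fun t ht => ?_
    have h1 := gammaWeight_pos ht
    have h2 : exp (-t) ^ n ≤ 1 := pow_le_one₀ (exp_pos _).le (by simpa using ht.le)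
    have h3 := exp_pos (-t)
    rw [abs_of_nonneg (mul_nonneg h1.le (by linarith))]
    have := gammaWeight_le ht
    simp only [pow_zero, one_mul]
    refine (mul_le_of_le_one_right h1.le ?_).trans this
    have : 0 < exp (-t) ^ n := by positivity
    linarith
  induction n with
  | zero => simp [eulerMascheroniSeq_zero]
  | succ n ih =>
    obtain ⟨hi, he⟩ := integral_exp_neg_mul_sub_exp_neg_mul_div (a := n + 1) (b := n + 2)
      (by positivity) (by linarith)
    have hg := integrableOn_pow_mul_exp_neg_mul 0 (r := n + 1) (by positivity)
    have he' := integral_pow_mul_exp_neg_mul 0 (r := n + 1) (by positivity)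
    have key : ∫ t in Ioi 0, gammaWeight t * (1 - exp (-t) ^ (n + 1)) =
        ∫ t in Ioi 0, (gammaWeight t * (1 - exp (-t) ^ n) + (t ^ 0 * exp (-((n + 1) * t)) -
          (exp (-((n + 1) * t)) - exp (-((n + 2) * t))) / t)) := by
      refine setIntegral_congr_fun measurableSet_Ioi fun t ht => ?_
      have h1 : exp (-((n + 1) * t)) = exp (-t) ^ (n + 1) := by
        rw [← exp_nat_mul]; push_cast; ring_nf
      have h2 : exp (-((n + 2) * t)) = exp (-t) ^ (n + 2) := by
        rw [← exp_nat_mul]; push_cast; ring_nf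
      have h3 := (one_sub_exp_neg_pos ht).ne'
      have h4 : t ≠ 0 := ne_of_gt ht
      simp only [h1, h2, gammaWeight]
      field_simp
      ring
    have hs : IntegrableOn (fun t : ℝ => t ^ 0 * exp (-((n + 1) * t)) -
        (exp (-((n + 1) * t)) - exp (-((n + 2) * t))) / t) (Ioi 0) := hg.sub hi
    rw [key, integral_add (hint n) hs, integral_sub hg hi, ih, he, he',
      eulerMascheroniSeq, eulerMascheroniSeq, harmonic_succ, log_div (by positivity) (by positivity)]
    push_cast
    simp
    ring_nf

lemma gammaMoment_zero : gammaMoment 0 = eulerMascheroniConstant := by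
  refine tendsto_nhds_unique ?_ tendsto_eulerMascheroniSeq
  rw [show eulerMascheroniSeq = fun n => ∫ t in Ioi 0, gammaWeight t * (1 - exp (-t) ^ n) from
    funext fun n => (integral_gammaWeight_mul_one_sub_exp_pow n).symm, gammaMoment]
  refine tendsto_integral_of_dominated_convergence (fun t => exp (-t)) (fun n => ?_) ?_
    (fun n => ?_) ?_
  · exact (measurable_gammaWeight.mul (by fun_prop)).aestronglyMeasurable
  · exact integrableOn_exp_neg_Ioi 0
  · filter_upwards [ae_restrict_mem measurableSet_Ioi] with t ht
    have h1 := gammaWeight_pos ht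
    have h2 : exp (-t) ^ n ≤ 1 := pow_le_one₀ (exp_pos _).le (by simpa using ht.out.le)
    have h3 : 0 < exp (-t) ^ n := by positivity
    rw [norm_of_nonneg (mul_nonneg h1.le (by linarith))]
    exact (mul_le_of_le_one_right h1.le (by linarith)).trans (gammaWeight_le ht)
  · filter_upwards [ae_restrict_mem measurableSet_Ioi] with t ht
    have := tendsto_pow_atTop_nhds_zero_of_lt_one (exp_pos (-t)).le
      (by simpa using ht)
    simpa using (this.const_sub 1).const_mul (gammaWeight t)

lemma integral_pow_mul_one_sub_exp_pow (k n : ℕ) :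
    IntegrableOn (fun t => t ^ k * (1 - exp (-t)) ^ n * exp (-t)) (Ioi 0) ∧
    ∫ t in Ioi 0, t ^ k * (1 - exp (-t)) ^ n * exp (-t) =
      ∑ i ∈ Finset.range (n + 1),
        (n.choose i : ℝ) * (-1) ^ i * (k.factorial / ((i : ℝ) + 1) ^ (k + 1)) := by
  have hrw : (fun t => t ^ k * (1 - exp (-t)) ^ n * exp (-t)) = fun t =>
      ∑ i ∈ Finset.range (n + 1),
        (n.choose i : ℝ) * (-1) ^ i * (t ^ k * exp (-((i + 1) * t))) := by
    ext t
    rw [sub_eq_neg_add, add_pow, Finset.mul_sum, Finset.sum_mul]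
    refine Finset.sum_congr rfl fun i _ => ?_
    have h1 : exp (-((i + 1) * t)) = exp (-t) ^ (i + 1) := by
      rw [← exp_nat_mul]; push_cast; ring_nf
    rw [h1, neg_pow]
    ring
  have hi (i : ℕ) : IntegrableOn
      (fun t : ℝ => (n.choose i : ℝ) * (-1) ^ i * (t ^ k * exp (-((i + 1) * t)))) (Ioi 0) :=
    (integrableOn_pow_mul_exp_neg_mul k (by positivity)).const_mul _
  rw [hrw]
  refine ⟨integrable_finsetSum _ fun i _ => hi i, ?_⟩
  rw [integral_finsetSum _ fun i _ => hi i]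
  refine Finset.sum_congr rfl fun i _ => ?_
  rw [integral_const_mul, integral_pow_mul_exp_neg_mul k (by positivity)]

lemma hasDerivAt_gammaNode (t : ℝ) :
    HasDerivAt gammaNode (1 - exp (-t) + t * exp (-t)) t := by
  have h : HasDerivAt (fun t : ℝ => exp (-t)) (exp (-t) * -1) t := (hasDerivAt_neg t).exp
  convert! (hasDerivAt_id t).mul (h.const_sub 1) using 1
  simp

lemma tendsto_gammaNode_pow_mul_exp_neg (n : ℕ) :
    Tendsto (fun t => gammaNode t ^ n * exp (-t)) atTop (nhds 0) := by
  refine tendsto_of_tendsto_of_tendsto_of_le_of_le' tendsto_const_nhds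
    (tendsto_pow_mul_exp_neg_atTop_nhds_zero n) ?_ ?_
  · filter_upwards [eventually_gt_atTop 0] with t ht
    have := gammaNode_pos ht
    positivity
  · filter_upwards [eventually_gt_atTop 0] with t ht
    have := gammaNode_pos ht
    have := gammaNode_le ht
    gcongr

lemma gammaMoment_succ (m : ℕ) :
    gammaMoment (m + 1) = (m.factorial : ℝ) * ∑ i ∈ Finset.range (m + 1 + 1),
      ((m + 1).choose i : ℝ) * (-1 : ℝ) ^ i * (((m + 1 : ℕ) : ℝ) - 2 * i - 1) /
        ((i : ℝ) + 1) ^ (m + 1 + 1) := by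
  set n := m + 1 with hn
  obtain ⟨i1, e1⟩ := integral_pow_mul_one_sub_exp_pow n n
  obtain ⟨i2, e2⟩ := integral_pow_mul_one_sub_exp_pow m n
  have hnpos : (0 : ℝ) < n := by rw [hn]; positivity
  set D : ℝ → ℝ := fun t => n * gammaNode t ^ m * (1 - exp (-t) + t * exp (-t)) * exp (-t) -
    gammaNode t ^ n * exp (-t) with hD
  have pointwise : ∀ t ∈ Ioi (0 : ℝ), gammaNode t ^ n * gammaWeight t =
      ((n + 1) / n * (t ^ n * (1 - exp (-t)) ^ n * exp (-t)) -
        2 * (t ^ m * (1 - exp (-t)) ^ n * exp (-t))) + 1 / n * D t := by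
    intro t ht
    have h3 := (one_sub_exp_neg_pos ht).ne'
    have h4 : t ≠ 0 := ne_of_gt ht
    simp only [hD, gammaWeight, gammaNode, mul_pow]
    simp only [hn, pow_succ] at *
    field_simp
    ring
  have iD : IntegrableOn D (Ioi 0) := by
    have := (((integrableOn_gammaNode_pow_mul n).sub
      ((i1.const_mul ((n + 1) / n)).sub (i2.const_mul 2))).const_mul (n : ℝ))
    refine (integrableOn_congr_fun (fun t ht => ?_) measurableSet_Ioi).1 this
    simp only [Pi.sub_apply]
    rw [pointwise t ht]
    field_simp
    ring
  have eD : ∫ t in Ioi 0, D t = 0 := by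
    have hd (t : ℝ) : HasDerivAt (fun t => gammaNode t ^ n * exp (-t)) (D t) t := by
      have h : HasDerivAt (fun t : ℝ => exp (-t)) (exp (-t) * -1) t := (hasDerivAt_neg t).exp
      convert! ((hasDerivAt_gammaNode t).fun_pow n).mul h using 1
      simp only [hD, hn, Nat.add_sub_cancel]
      ring
    have := integral_Ioi_of_hasDerivAt_of_tendsto' (a := 0) (fun t _ => hd t) iD
      (tendsto_gammaNode_pow_mul_exp_neg n)
    rw [this]
    simp [gammaNode, hn]
  have is : IntegrableOn (fun t => (n + 1) / n * (t ^ n * (1 - exp (-t)) ^ n * exp (-t)) -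
      2 * (t ^ m * (1 - exp (-t)) ^ n * exp (-t))) (Ioi 0) :=
    (i1.const_mul _).sub (i2.const_mul _)
  rw [gammaMoment, setIntegral_congr_fun measurableSet_Ioi pointwise,
    integral_add is (iD.const_mul _),
    integral_sub (i1.const_mul _) (i2.const_mul _), integral_const_mul, integral_const_mul,
    integral_const_mul, eD, e1, e2, mul_zero, add_zero, Finset.mul_sum, Finset.mul_sum,
    Finset.mul_sum, ← Finset.sum_sub_distrib]
  refine Finset.sum_congr rfl fun i _ => ?_
  have hf : (n.factorial : ℝ) = n * m.factorial := by
    rw [hn, Nat.factorial_succ]; push_cast; ring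
  rw [hf, hn, pow_succ]
  have : ((m + 1 : ℕ) : ℝ) ≠ 0 := by positivity
  field_simp
  ring

open Polynomial in
/-- The integral of the square of a polynomial in `gammaNode` against `gammaWeight`. -/
noncomputable def gammaEnergy (p : ℝ[X]) : ℝ :=
  ∫ t in Ioi 0, p.eval (gammaNode t) ^ 2 * gammaWeight t

/-- The Hankel matrix of the moments `gammaMoment`. -/
noncomputable def gammaHankel (N : ℕ) : Matrix (Fin N) (Fin N) ℝ :=
  Matrix.of fun i j => gammaMoment (i.val + j.val)

section Energy
open Polynomial

lemma eval_gammaNode_sq_mul_eq_sum {N : ℕ} {p : ℝ[X]} (hp : p ∈ degreeLT ℝ N) (t : ℝ) :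
    p.eval (gammaNode t) ^ 2 * gammaWeight t =
      ∑ i : Fin N, ∑ j : Fin N, p.coeff i * p.coeff j *
        (gammaNode t ^ (i.val + j.val) * gammaWeight t) := by
  rw [eval_eq_sum_degreeLTEquiv hp, sq, Finset.sum_mul_sum, Finset.sum_mul]
  refine Finset.sum_congr rfl fun i _ => ?_
  rw [Finset.sum_mul]
  refine Finset.sum_congr rfl fun j _ => ?_
  simp only [degreeLTEquiv, LinearEquiv.coe_mk, LinearMap.coe_mk, AddHom.coe_mk]
  ring

lemma integrableOn_eval_gammaNode_sq_mul (p : ℝ[X]) :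
    IntegrableOn (fun t => p.eval (gammaNode t) ^ 2 * gammaWeight t) (Ioi 0) := by
  have hp : p ∈ degreeLT ℝ (p.natDegree + 1) :=
    mem_degreeLT.2 (degree_le_natDegree.trans_lt (by exact_mod_cast Nat.lt_succ_self _))
  simp_rw [eval_gammaNode_sq_mul_eq_sum hp]
  exact integrable_finsetSum _ fun i _ => integrable_finsetSum _ fun j _ =>
    (integrableOn_gammaNode_pow_mul _).const_mul _

lemma dotProduct_gammaHankel_mulVec {N : ℕ} {p : ℝ[X]} (hp : p ∈ degreeLT ℝ N) :
    (fun i : Fin N => p.coeff i) ⬝ᵥ (gammaHankel N).mulVec (fun i => p.coeff i) =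
      gammaEnergy p := by
  simp_rw [gammaEnergy, eval_gammaNode_sq_mul_eq_sum hp]
  have hi (i j : Fin N) := (integrableOn_gammaNode_pow_mul (i.val + j.val)).const_mul
    (p.coeff i * p.coeff j)
  rw [integral_finsetSum _ fun i _ => integrable_finsetSum _ fun j _ => hi i j]
  refine Finset.sum_congr rfl fun i _ => ?_
  rw [integral_finsetSum _ fun j _ => hi i j, Matrix.mulVec, dotProduct, Finset.mul_sum]
  refine Finset.sum_congr rfl fun j _ => ?_
  rw [integral_const_mul, gammaHankel, Matrix.of_apply, gammaMoment]
  ring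

lemma exists_mem_degreeLT_coeff_eq {N : ℕ} (z : Fin N → ℝ) :
    ∃ p ∈ degreeLT ℝ N, (fun i : Fin N => p.coeff i) = z := by
  refine ⟨(degreeLTEquiv ℝ N).symm z, ((degreeLTEquiv ℝ N).symm z).2, ?_⟩
  exact (degreeLTEquiv ℝ N).apply_symm_apply z

lemma gammaEnergy_pos {p : ℝ[X]} (hp : p ≠ 0) : 0 < gammaEnergy p := by
  have hnn : ∀ t ∈ Ioi (0 : ℝ), 0 ≤ p.eval (gammaNode t) ^ 2 * gammaWeight t := fun t ht =>
    mul_nonneg (sq_nonneg _) (gammaWeight_pos ht).le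
  rw [gammaEnergy, setIntegral_pos_iff_support_of_nonneg_ae
    ((ae_restrict_mem measurableSet_Ioi).mono hnn) (integrableOn_eval_gammaNode_sq_mul p)]
  have hfin : (Ioi 0 ∩ gammaNode ⁻¹' (p.roots.toFinset : Set ℝ)).Finite :=
    Set.Finite.of_finite_image ((p.roots.toFinset.finite_toSet).subset (by
      rintro _ ⟨t, ht, rfl⟩
      exact ht.2)) (strictMonoOn_gammaNode.injOn.mono inter_subset_left)
  have hsub : Ioi (0 : ℝ) \ (Ioi 0 ∩ gammaNode ⁻¹' (p.roots.toFinset : Set ℝ)) ⊆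
      Function.support (fun t => p.eval (gammaNode t) ^ 2 * gammaWeight t) ∩ Ioi 0 := by
    rintro t ⟨ht, hroot⟩
    refine ⟨mul_ne_zero (pow_ne_zero _ fun h => hroot ⟨ht, ?_⟩) (gammaWeight_pos ht).ne', ht⟩
    simpa [hp] using h
  refine lt_of_lt_of_le ?_ (measure_mono hsub)
  rw [measure_sdiff_null (hfin.measure_zero _)]
  simp

lemma posDef_gammaHankel (N : ℕ) : (gammaHankel N).PosDef := by
  refine Matrix.PosDef.of_dotProduct_mulVec_pos ?_ fun z hz => ?_
  · ext i j
    simp [gammaHankel, add_comm]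
  · obtain ⟨p, hp, rfl⟩ := exists_mem_degreeLT_coeff_eq z
    rw [star_trivial, dotProduct_gammaHankel_mulVec hp]
    refine gammaEnergy_pos ?_
    rintro rfl
    exact hz (by ext; simp)

end Energy

lemma Matrix.PosDef.isLeast_det_div_det_submatrix_succ {N : ℕ}
    {M : Matrix (Fin (N + 1)) (Fin (N + 1)) ℝ} (hM : M.PosDef) :
    IsLeast {s | ∃ z : Fin (N + 1) → ℝ, z 0 = 1 ∧ z ⬝ᵥ M.mulVec z = s}
      (M.det / (M.submatrix Fin.succ Fin.succ).det) := by
  set q := (M.submatrix Fin.succ Fin.succ).det with hq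
  have hq0 : q ≠ 0 := (hM.submatrix (Fin.succ_injective N)).det_pos.ne'
  set y : Fin (N + 1) → ℝ := fun i => M.adjugate i 0 / q with hy
  have hy0 : y 0 = 1 := by
    simp only [hy, Matrix.adjugate_fin_succ_eq_det_submatrix]
    simp [← hq, hq0]
  have hMy : M.mulVec y = Pi.single 0 (M.det / q) := by
    ext i
    have := congrFun (congrFun (Matrix.mul_adjugate M) i) 0
    rw [Matrix.mul_apply] at this
    simp only [Matrix.mulVec, dotProduct, hy, ← mul_div_assoc, ← Finset.sum_div, this]
    by_cases h : i = 0
    · subst h; simp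
    · simp [h]
  refine ⟨⟨y, hy0, by rw [hMy]; simp [hy0]⟩, ?_⟩
  rintro _ ⟨z, hz, rfl⟩
  set d := z - y with hd
  have hd0 : d 0 = 0 := by simp [hd, hz, hy0]
  have hzd : z = y + d := by simp [hd]
  have hnn : 0 ≤ d ⬝ᵥ M.mulVec d := by
    simpa using hM.posSemidef.dotProduct_mulVec_nonneg d
  have hsymm : y ⬝ᵥ M.mulVec d = d ⬝ᵥ M.mulVec y := by
    have ht : M.transpose = M := by simpa using hM.1.eq
    rw [Matrix.dotProduct_mulVec, ← Matrix.mulVec_transpose, ht, dotProduct_comm]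
  rw [hzd, Matrix.mulVec_add, add_dotProduct, dotProduct_add, dotProduct_add, hsymm, hMy]
  simp only [dotProduct_single, hy0, hd0]
  linarith

lemma Matrix.det_sub_det_of_forall_ne_eq {N : ℕ} {A B : Matrix (Fin (N + 1)) (Fin (N + 1)) ℝ}
    (h : ∀ i j, (i, j) ≠ (0, 0) → A i j = B i j) :
    B.det - A.det = (B 0 0 - A 0 0) * (B.submatrix Fin.succ Fin.succ).det := by
  have hs (j : Fin (N + 1)) : A.submatrix Fin.succ j.succAbove =
      B.submatrix Fin.succ j.succAbove := by
    ext k l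
    exact h _ _ (by simp)
  rw [Matrix.det_succ_row_zero, Matrix.det_succ_row_zero, Fin.sum_univ_succ, Fin.sum_univ_succ]
  simp only [hs, h 0 (Fin.succ _) (by simp)]
  simp only [Fin.val_zero, pow_zero, one_mul, Fin.succAbove_zero]
  ring

section Approximation
open Polynomial

lemma isLeast_gammaEnergy (n : ℕ) :
    IsLeast {s | ∃ p ∈ degreeLT ℝ (n + 1), p.coeff 0 = 1 ∧ gammaEnergy p = s}
      ((gammaHankel (n + 1)).det / ((gammaHankel (n + 1)).submatrix Fin.succ Fin.succ).det) := by
  convert! (posDef_gammaHankel (n + 1)).isLeast_det_div_det_submatrix_succ using 1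
  ext s
  constructor
  · rintro ⟨p, hp, h0, rfl⟩
    exact ⟨fun i => p.coeff i, h0, dotProduct_gammaHankel_mulVec hp⟩
  · rintro ⟨z, h0, rfl⟩
    obtain ⟨p, hp, rfl⟩ := exists_mem_degreeLT_coeff_eq z
    exact ⟨p, hp, h0, (dotProduct_gammaHankel_mulVec hp).symm⟩

lemma pow_le_factorial_div_mul_exp {η x : ℝ} (hη : 0 < η) (hx : 0 ≤ x) (k : ℕ) :
    x ^ k ≤ k.factorial / η ^ k * exp (η * x) := by
  have h := pow_div_factorial_le_exp (η * x) (by positivity) k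
  rw [div_le_iff₀ (by positivity), mul_pow] at h
  rw [div_mul_eq_mul_div, le_div_iff₀ (by positivity)]
  linarith

lemma Polynomial.exists_abs_eval_le_mul_exp (p : ℝ[X]) {η : ℝ} (hη : 0 < η) :
    ∃ K, 0 < K ∧ ∀ x, 0 ≤ x → |p.eval x| ≤ K * exp (η * x) := by
  induction p using Polynomial.induction_on' with
  | add p q hp hq =>
    obtain ⟨K, hK, h⟩ := hp
    obtain ⟨L, hL, h'⟩ := hq
    refine ⟨K + L, by positivity, fun x hx => ?_⟩
    rw [eval_add, add_mul]
    exact (abs_add_le _ _).trans (add_le_add (h x hx) (h' x hx))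
  | monomial k a =>
    refine ⟨(|a| + 1) * (k.factorial / η ^ k), by positivity, fun x hx => ?_⟩
    rw [eval_monomial, abs_mul, abs_of_nonneg (pow_nonneg hx k), mul_assoc]
    gcongr
    · linarith
    · exact pow_le_factorial_div_mul_exp hη hx k

lemma exp_sub_sum_le {y : ℝ} (hy : 0 ≤ y) (n : ℕ) :
    exp y - ∑ m ∈ Finset.range n, y ^ m / m.factorial ≤ (1 / 2) ^ n * exp (2 * y) := by
  have hs := summable_pow_div_factorial y
  have hs2 := summable_pow_div_factorial (2 * y)
  have he (z : ℝ) : exp z = ∑' m : ℕ, z ^ m / m.factorial := by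
    rw [exp_eq_exp_ℝ, NormedSpace.exp_eq_tsum_div]
  rw [he y, he (2 * y), ← hs.sum_add_tsum_nat_add n, ← hs2.sum_add_tsum_nat_add n, mul_add,
    add_sub_cancel_left, ← tsum_mul_left]
  refine le_add_of_nonneg_of_le (mul_nonneg (by positivity)
    (Finset.sum_nonneg fun m _ => by positivity)) (Summable.tsum_le_tsum (fun m => ?_)
    ((summable_nat_add_iff n).2 hs) (((summable_nat_add_iff n).2 hs2).mul_left _))
  have h : (1 / 2 : ℝ) ^ n * ((2 * y) ^ (m + n) / (m + n).factorial) =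
      2 ^ m * (y ^ (m + n) / (m + n).factorial) := by
    rw [mul_pow, pow_add 2 m n, one_div, inv_pow]
    field_simp
  rw [h]
  exact le_mul_of_one_le_left (by positivity) (one_le_pow₀ one_le_two)

lemma abs_exp_neg_sub_sum_le {y : ℝ} (hy : 0 ≤ y) (n : ℕ) :
    |exp (-y) - ∑ m ∈ Finset.range n, (-y) ^ m / m.factorial| ≤ (1 / 2) ^ n * exp (2 * y) := by
  have h := Complex.norm_exp_sub_sum_le_exp_norm_sub_sum (-y : ℝ) n
  rw [Complex.norm_real, norm_neg, norm_of_nonneg hy] at h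
  rw [← Real.norm_eq_abs, ← Complex.norm_real]
  push_cast at h ⊢
  exact h.trans (exp_sub_sum_le hy n)

/-- The exponential `e^{-δ x}` is approximated by its Taylor polynomials, uniformly on `[0, ∞)`
with respect to the weight `e^{2 δ x}`. -/
lemma exists_polynomial_abs_sub_exp_neg_le {δ ε : ℝ} (hδ : 0 < δ) (hε : 0 < ε) :
    ∃ p : ℝ[X], p.eval 0 = 1 ∧
      ∀ x, 0 ≤ x → |p.eval x - exp (-(δ * x))| ≤ ε * exp (2 * δ * x) := by
  obtain ⟨N, hN0, hN⟩ : ∃ N : ℕ, 0 < N ∧ (1 / 2 : ℝ) ^ N < ε :=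
    ((eventually_gt_atTop 0).and ((tendsto_pow_atTop_nhds_zero_of_lt_one (by norm_num)
      (by norm_num : (1 / 2 : ℝ) < 1)).eventually_lt_const hε)).exists
  refine ⟨∑ m ∈ Finset.range N, C ((-δ) ^ m / m.factorial) * X ^ m, ?_, fun x hx => ?_⟩
  · obtain ⟨N, rfl⟩ := Nat.exists_eq_succ_of_ne_zero hN0.ne'
    simp [eval_finsetSum, Finset.sum_range_succ']
  · have h2 : (∑ m ∈ Finset.range N, C ((-δ) ^ m / m.factorial) * X ^ m : ℝ[X]).eval x =
        ∑ m ∈ Finset.range N, (-(δ * x)) ^ m / m.factorial := by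
      rw [eval_finsetSum]
      refine Finset.sum_congr rfl fun m _ => ?_
      rw [eval_mul, eval_C, eval_pow, eval_X, neg_mul_eq_neg_mul, mul_pow]
      ring
    rw [h2, abs_sub_comm]
    refine (abs_exp_neg_sub_sum_le (by positivity) N).trans ?_
    rw [← mul_assoc]
    gcongr

lemma exists_polynomial_abs_sub_exp_neg_nat_mul_le {δ : ℝ} (hδ : 0 < δ) (n : ℕ) :
    ∀ c, 2 * δ < c → ∀ ε, 0 < ε → ∃ p : ℝ[X], p.eval 0 = 1 ∧
      ∀ x, 0 ≤ x → |p.eval x - exp (-(n * δ * x))| ≤ ε * exp (c * x) := by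
  induction n with
  | zero =>
    intro c hc ε hε
    refine ⟨1, by simp, fun x hx => ?_⟩
    simp only [eval_one, Nat.cast_zero, zero_mul, neg_zero, exp_zero, sub_self, abs_zero]
    positivity
  | succ n ih =>
    intro c hc ε hε
    obtain ⟨T, hT0, hT⟩ := exists_polynomial_abs_sub_exp_neg_le hδ (half_pos hε)
    obtain ⟨K, hK, hTK⟩ := T.exists_abs_eval_le_mul_exp (η := (c - 2 * δ) / 2) (by linarith)
    obtain ⟨p, hp0, hp⟩ := ih ((c + 2 * δ) / 2) (by linarith) (ε / 2 / K) (by positivity)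
    refine ⟨p * T, by simp [hp0, hT0], fun x hx => ?_⟩
    set e := exp (-(n * δ * x)) with he
    set f := exp (-(δ * x)) with hf
    have h1 : exp (-(((n + 1 : ℕ) : ℝ) * δ * x)) = e * f := by
      rw [he, hf, ← exp_add]; push_cast; ring_nf
    have he1 : e ≤ 1 := by
      rw [he, exp_le_one_iff]
      have : 0 ≤ n * δ * x := by positivity
      linarith
    have hc2 : exp (c * x) = exp ((c + 2 * δ) / 2 * x) * exp ((c - 2 * δ) / 2 * x) := by
      rw [← exp_add]; ring_nf
    have hc3 : exp (2 * δ * x) ≤ exp (c * x) := by gcongr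
    have hsplit : (p * T).eval x - e * f = (p.eval x - e) * T.eval x + e * (T.eval x - f) := by
      rw [eval_mul]; ring
    rw [h1, hsplit]
    refine (abs_add_le _ _).trans ?_
    rw [abs_mul, abs_mul, abs_of_pos (exp_pos _ : 0 < e)]
    have b1 : |p.eval x - e| * |T.eval x| ≤ ε / 2 * exp (c * x) := by
      calc _ ≤ (ε / 2 / K * exp ((c + 2 * δ) / 2 * x)) * (K * exp ((c - 2 * δ) / 2 * x)) :=
            mul_le_mul (hp x hx) (hTK x hx) (abs_nonneg _) (by positivity)
        _ = _ := by rw [hc2]; field_simp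
    have b2 : e * |T.eval x - f| ≤ ε / 2 * exp (c * x) := by
      calc _ ≤ 1 * (ε / 2 * exp (2 * δ * x)) :=
            mul_le_mul he1 (hT x hx) (abs_nonneg _) zero_le_one
        _ ≤ _ := by rw [one_mul]; gcongr
    linarith

lemma tendsto_integral_exp_neg_gammaNode :
    Tendsto (fun n : ℕ => ∫ t in Ioi 0, exp (-(n * (1 / 8) * gammaNode t)) ^ 2 * gammaWeight t)
      atTop (nhds 0) := by
  have h0 : ∫ _ in Ioi (0 : ℝ), (0 : ℝ) = 0 := integral_zero _ _
  refine Eq.subst (motive := fun z => Tendsto _ _ (nhds z)) h0 ?_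
  refine tendsto_integral_of_dominated_convergence (fun t => exp (-t)) (fun n => ?_)
    (integrableOn_exp_neg_Ioi 0) (fun n => ?_) ?_
  · have := measurable_gammaNode
    exact (Measurable.mul (by fun_prop) measurable_gammaWeight).aestronglyMeasurable
  · filter_upwards [ae_restrict_mem measurableSet_Ioi] with t ht
    have h1 := gammaWeight_pos ht
    have h2 := gammaNode_pos ht
    rw [norm_of_nonneg (by positivity)]
    refine (mul_le_of_le_one_left h1.le (pow_le_one₀ (exp_pos _).le ?_)).trans (gammaWeight_le ht)
    rw [exp_le_one_iff, neg_nonpos]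
    positivity
  · filter_upwards [ae_restrict_mem measurableSet_Ioi] with t ht
    have h2 := gammaNode_pos ht
    have h3 : Tendsto (fun n : ℕ => (n : ℝ) * (1 / 8) * gammaNode t) atTop atTop :=
      (tendsto_natCast_atTop_atTop.atTop_mul_const (by norm_num)).atTop_mul_const h2
    simpa using ((tendsto_exp_neg_atTop_nhds_zero.comp h3).pow 2).mul_const (gammaWeight t)

lemma exists_polynomial_gammaEnergy_lt {ε : ℝ} (hε : 0 < ε) :
    ∃ p : ℝ[X], p.coeff 0 = 1 ∧ gammaEnergy p < ε := by
  obtain ⟨n, hn⟩ := (tendsto_integral_exp_neg_gammaNode.eventually_lt_const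
    (show (0 : ℝ) < ε / 4 by positivity)).exists
  obtain ⟨p, hp0, hp⟩ := exists_polynomial_abs_sub_exp_neg_nat_mul_le
    (δ := 1 / 8) (by norm_num) n (7 / 16) (by norm_num) (√(ε / 64)) (by positivity)
  refine ⟨p, by rw [coeff_zero_eq_eval_zero, hp0], ?_⟩
  set f : ℝ → ℝ := fun t => exp (-(n * (1 / 8) * gammaNode t)) ^ 2 * gammaWeight t with hf
  have hfi : IntegrableOn f (Ioi 0) := by
    have := measurable_gammaNode
    refine integrableOn_of_le_pow_mul_exp (Measurable.mul (by fun_prop) measurable_gammaWeight)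
      1 0 one_pos fun t ht => ?_
    have h1 := gammaWeight_pos ht
    have h2 := gammaNode_pos ht
    rw [abs_of_nonneg (by positivity)]
    simp only [one_mul, pow_zero]
    refine (mul_le_of_le_one_left h1.le (pow_le_one₀ (exp_pos _).le ?_)).trans (gammaWeight_le ht)
    rw [exp_le_one_iff, neg_nonpos]
    positivity
  have hgi := integrableOn_pow_mul_exp_neg_mul 0 (r := 1 / 8) (by norm_num)
  have hge := integral_pow_mul_exp_neg_mul 0 (r := 1 / 8) (by norm_num)
  have hle : gammaEnergy p ≤
      ∫ t in Ioi 0, (2 * f t + 2 * (ε / 64) * (t ^ 0 * exp (-(1 / 8 * t)))) := by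
    refine setIntegral_mono_on (integrableOn_eval_gammaNode_sq_mul p)
      ((hfi.const_mul 2).add (hgi.const_mul _)) measurableSet_Ioi fun t ht => ?_
    have h1 := gammaWeight_pos ht
    have h2 := gammaNode_pos ht
    have h3 := hp _ h2.le
    set e := exp (-(n * (1 / 8) * gammaNode t)) with he
    have h4 : (p.eval (gammaNode t) - e) ^ 2 ≤ ε / 64 * exp (7 / 8 * gammaNode t) := by
      rw [← sq_abs]
      refine (pow_le_pow_left₀ (abs_nonneg _) h3 2).trans_eq ?_
      rw [mul_pow, sq_sqrt (by positivity), ← exp_nat_mul]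
      ring_nf
    have h5 : exp (7 / 8 * gammaNode t) * gammaWeight t ≤ exp (-(1 / 8 * t)) := by
      calc _ ≤ exp (7 / 8 * t) * exp (-t) := by
            gcongr
            · exact gammaNode_le ht
            · exact gammaWeight_le ht
        _ = _ := by rw [← exp_add]; ring_nf
    have h6 : p.eval (gammaNode t) ^ 2 ≤ 2 * e ^ 2 + 2 * (p.eval (gammaNode t) - e) ^ 2 := by
      nlinarith [sq_nonneg (p.eval (gammaNode t) - 2 * e)]
    calc p.eval (gammaNode t) ^ 2 * gammaWeight t
        ≤ (2 * e ^ 2 + 2 * (ε / 64 * exp (7 / 8 * gammaNode t))) * gammaWeight t := by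
          gcongr
          linarith
      _ = 2 * f t + 2 * (ε / 64) * (exp (7 / 8 * gammaNode t) * gammaWeight t) := by
          simp only [hf, ← he]; ring
      _ ≤ 2 * f t + 2 * (ε / 64) * (t ^ 0 * exp (-(1 / 8 * t))) := by
          rw [pow_zero, one_mul]
          gcongr
  rw [integral_add (hfi.const_mul 2) (hgi.const_mul _), integral_const_mul, integral_const_mul,
    hge] at hle
  norm_num at hle
  linarith

end Approximation

end

/-- **Rational approximations of the Euler–Mascheroni constant.** Set `a 0 := 0` and, for
`n ≥ 1`, `a n := (n-1)! Σ_{i=0}^{n} C(n,i) (-1)^i (n-2i-1)/(i+1)^{n+1}`, and define the Hankel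
determinants `P n := -det (a_{i+j})_{i,j=0}^{n+1}` and `Q n := det (a_{i+j+2})_{i,j=0}^{n}`.
Then for every `n`: `Q n > 0`, `0 < P n / Q n < γ`, `P n / Q n ≤ P (n+1) / Q (n+1)`, and
`P n / Q n → γ` where `γ` is the Euler–Mascheroni constant. -/
theorem stmt_9 (a : ℕ → ℝ) (ha0 : a 0 = 0)
    (ha : ∀ n : ℕ, 1 ≤ n → a n = (Nat.factorial (n - 1) : ℝ) *
      ∑ i ∈ Finset.range (n + 1),
        (n.choose i : ℝ) * (-1 : ℝ) ^ i * ((n : ℝ) - 2 * i - 1) / ((i : ℝ) + 1) ^ (n + 1))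
    (P Q : ℕ → ℝ)
    (hP : ∀ n : ℕ, P n = -Matrix.det (Matrix.of fun i j : Fin (n + 2) => a (i.val + j.val)))
    (hQ : ∀ n : ℕ, Q n = Matrix.det (Matrix.of fun i j : Fin (n + 1) => a (i.val + j.val + 2))) :
    (∀ n : ℕ, 0 < Q n) ∧
      (∀ n : ℕ, 0 < P n / Q n ∧ P n / Q n < Real.eulerMascheroniConstant) ∧
      (∀ n : ℕ, P n / Q n ≤ P (n + 1) / Q (n + 1)) ∧
      Tendsto (fun n : ℕ => P n / Q n) atTop (nhds Real.eulerMascheroniConstant) := by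
  have ham (k : ℕ) : a (k + 1) = gammaMoment (k + 1) := by
    rw [ha _ (Nat.le_add_left 1 k), gammaMoment_succ, Nat.add_sub_cancel]
  set r : ℕ → ℝ := fun n => (gammaHankel (n + 2)).det /
    ((gammaHankel (n + 2)).submatrix Fin.succ Fin.succ).det with hr
  have hQH (n : ℕ) : Q n = ((gammaHankel (n + 2)).submatrix Fin.succ Fin.succ).det := by
    rw [hQ]
    congr 1
    ext i j
    simp only [gammaHankel, Matrix.of_apply, Matrix.submatrix_apply, Fin.val_succ]
    rw [ham]
    congr 1
    ring
  have hQpos (n : ℕ) : 0 < Q n := by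
    rw [hQH]
    exact ((posDef_gammaHankel (n + 2)).submatrix (Fin.succ_injective _)).det_pos
  have hPQ (n : ℕ) : P n / Q n = Real.eulerMascheroniConstant - r n := by
    have h := Matrix.det_sub_det_of_forall_ne_eq (N := n + 1) (B := gammaHankel (n + 2))
      (A := Matrix.of fun i j : Fin (n + 2) => a (i.val + j.val)) (by
        intro i j hij
        have h0 : i.val + j.val ≠ 0 := by
          intro h
          apply hij
          rw [Prod.mk.injEq, Fin.ext_iff, Fin.ext_iff, Fin.val_zero]
          omega
        obtain ⟨k, hk⟩ := Nat.exists_eq_succ_of_ne_zero h0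
        simp only [gammaHankel, Matrix.of_apply, hk]
        exact ham k)
    rw [← hQH] at h
    have h00 : gammaHankel (n + 2) 0 0 = Real.eulerMascheroniConstant := by
      simp [gammaHankel, gammaMoment_zero]
    have ha00 : (Matrix.of fun i j : Fin (n + 2) => a (i.val + j.val)) 0 0 = 0 := by simp [ha0]
    rw [h00, ha00] at h
    have hq := (hQpos n).ne'
    rw [hP, hr]
    simp only [← hQH]
    field_simp
    linarith
  have hrpos (n : ℕ) : 0 < r n := by
    simp only [hr, ← hQH]
    exact div_pos (posDef_gammaHankel (n + 2)).det_pos (hQpos n)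
  have hmono : Antitone r := by
    intro m n hmn
    obtain ⟨p, hp, h0, hE⟩ := (isLeast_gammaEnergy (m + 1)).1
    have := (isLeast_gammaEnergy (n + 1)).2
      ⟨p, Polynomial.degreeLT_mono (by omega) hp, h0, rfl⟩
    rw [hE] at this
    exact this
  have hlim : Tendsto r atTop (nhds 0) := by
    rw [Metric.tendsto_atTop]
    intro ε hε
    obtain ⟨p, h0, hE⟩ := exists_polynomial_gammaEnergy_lt hε
    refine ⟨p.natDegree, fun n hn => ?_⟩
    have := (isLeast_gammaEnergy (n + 1)).2 ⟨p, Polynomial.mem_degreeLT.2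
      (Polynomial.degree_le_natDegree.trans_lt (by exact_mod_cast (by omega))), h0, rfl⟩
    rw [dist_zero_right, Real.norm_of_nonneg (hrpos n).le]
    exact this.trans_lt hE
  have hpos0 : 0 < P 0 / Q 0 := by
    refine div_pos ?_ (hQpos 0)
    have h1 : a 1 = 1 / 2 := by
      rw [ha 1 le_rfl]
      norm_num [Finset.sum_range_succ]
    rw [hP, Matrix.det_fin_two]
    simp [ha0, h1]
  refine ⟨hQpos, fun n => ⟨?_, ?_⟩, fun n => ?_, ?_⟩
  · have := hmono (Nat.zero_le n)
    rw [hPQ] at hpos0 ⊢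
    linarith
  · rw [hPQ]
    linarith [hrpos n]
  · rw [hPQ, hPQ]
    linarith [hmono (Nat.le_succ n)]
  · simp_rw [hPQ]
    simpa using hlim.const_sub Real.eulerMascheroniConstant
end

section
/- Set a_0 := 0 and, for n ≥ 1, a_n := Σ_{i=0}^{n-1} (n−1)!/i!, and define the Hankel determinants P_n := -det((a_{i+j})_{i,j=0}^{n+1}) and Q_n := det((a_{i+j+2})_{i,j=0}^{n}). Then for every n ≥ 0: Q_n > 0, 0 < P_n/Q_n < δ, P_n/Q_n ≤ P_{n+1}/Q_{n+1}, and lim_{n→∞} P_n/Q_n = δ, where δ := ∫_0^∞ e^{-x}/(1+x) dx is the Euler–Gompertz constant. -/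
open MeasureTheory Set Filter

open Polynomial

/-- A Hankel determinant with vanishing corner entry, expanded along its first row and column
by a Schur complement. -/
theorem Matrix.det_hankel_border (c : ℕ → ℝ) (hc : c 0 = 0) (n : ℕ)
    (h : IsUnit (Matrix.of fun i j : Fin (n + 1) => c (i.val + j.val + 2)).det) :
    (Matrix.of fun i j : Fin (n + 2) => c (i.val + j.val)).det =
      -((Matrix.of fun i j : Fin (n + 1) => c (i.val + j.val + 2)).det *
        ((fun i : Fin (n + 1) => c (i.val + 1)) ⬝ᵥ
          ((Matrix.of fun i j : Fin (n + 1) => c (i.val + j.val + 2))⁻¹.mulVec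
            fun i : Fin (n + 1) => c (i.val + 1)))) := by
  set B := (Matrix.of fun i j : Fin (n + 1) => c (i.val + j.val + 2)) with hB
  set b := fun i : Fin (n + 1) => c (i.val + 1) with hb
  let e : Fin (n + 1) ⊕ Unit ≃ Fin (n + 2) :=
    ((finSuccEquiv (n + 1)).trans (Equiv.optionEquivSumPUnit _)).symm
  have := B.invertibleOfIsUnitDet h
  rw [← Matrix.det_submatrix_equiv_self e]
  have : (Matrix.of fun i j : Fin (n + 2) => c (i.val + j.val)).submatrix e e =
      Matrix.fromBlocks B (Matrix.replicateCol Unit b) (Matrix.replicateRow Unit b) 0 := by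
    ext i j
    rcases i with i | i <;> rcases j with j | j <;>
      (simp [e, hB, hb, hc]; try (congr 1; ring))
  rw [this, Matrix.det_fromBlocks₁₁, zero_sub, Matrix.det_unique (n := Unit),
    Matrix.invOf_eq_nonsing_inv]
  simp [Matrix.mul_assoc, Matrix.mul_apply, Matrix.mulVec, dotProduct]

/-- For a positive definite functional `L` on polynomials, with moments `c` apart from the zeroth,
the quotient of Hankel determinants differs from `L 1` by the least value of `L ((1 - X * r) ^ 2)`
over polynomials `r` of degree at most `n`. -/
theorem exists_minimizer_hankel_quotient (L : ℝ[X] →ₗ[ℝ] ℝ)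
    (hL : ∀ p : ℝ[X], p ≠ 0 → 0 < L (p ^ 2))
    (c : ℕ → ℝ) (hc0 : c 0 = 0) (hc : ∀ n, L (X ^ (n + 1)) = c (n + 1)) (n : ℕ) :
    0 < (Matrix.of fun i j : Fin (n + 1) => c (i.val + j.val + 2)).det ∧
    ∃ q : ℝ[X], q.natDegree ≤ n ∧
      L 1 - -(Matrix.of fun i j : Fin (n + 2) => c (i.val + j.val)).det /
        (Matrix.of fun i j : Fin (n + 1) => c (i.val + j.val + 2)).det = L ((1 - X * q) ^ 2) ∧
      ∀ r : ℝ[X], r.natDegree ≤ n → L ((1 - X * q) ^ 2) ≤ L ((1 - X * r) ^ 2) := by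
  set B := (Matrix.of fun i j : Fin (n + 1) => c (i.val + j.val + 2)) with hB
  set b := fun i : Fin (n + 1) => c (i.val + 1) with hb
  let poly : (Fin (n + 1) → ℝ) → ℝ[X] := fun v => ∑ i, C (v i) * X ^ (i : ℕ)
  have hcoeff : ∀ v (i : Fin (n + 1)), (poly v).coeff i = v i := by
    intro v i
    simp only [poly, finsetSum_coeff, coeff_C_mul, coeff_X_pow, Fin.val_inj]
    simp
  have hdeg : ∀ v, (poly v).natDegree ≤ n := fun v =>
    natDegree_sum_le_of_forall_le _ _ fun i _ =>
      (natDegree_C_mul_X_pow_le _ _).trans (Nat.lt_succ_iff.mp i.2)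
  have hLb : ∀ v, L (X * poly v) = b ⬝ᵥ v := by
    intro v
    simp only [poly, Finset.mul_sum, map_sum, dotProduct]
    refine Finset.sum_congr rfl fun i _ => ?_
    rw [mul_left_comm, ← pow_succ', ← smul_eq_C_mul, map_smul, hc, smul_eq_mul, mul_comm]
  have hLB : ∀ v (i : Fin (n + 1)), L (X * poly v * (X * X ^ (i : ℕ))) = B.mulVec v i := by
    intro v i
    simp only [poly, Finset.mul_sum, Finset.sum_mul, map_sum, dotProduct, Matrix.mulVec]
    refine Finset.sum_congr rfl fun j _ => ?_
    have : X * (C (v j) * X ^ (j : ℕ)) * (X * X ^ (i : ℕ)) =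
        C (v j) * (X : ℝ[X]) ^ ((i : ℕ) + j + 1 + 1) := by ring
    rw [this, ← smul_eq_C_mul, map_smul, hc, smul_eq_mul, mul_comm]
    rfl
  have hLB' : ∀ v (r : ℝ[X]), r.natDegree ≤ n →
      L (X * poly v * (X * r)) = ∑ i : Fin (n + 1), r.coeff i * B.mulVec v i := by
    intro v r hr
    conv_lhs => rw [r.as_sum_range_C_mul_X_pow' (Nat.lt_succ_of_le hr)]
    rw [Finset.sum_range]
    simp only [Finset.mul_sum, map_sum]
    refine Finset.sum_congr rfl fun i _ => ?_
    rw [mul_left_comm X, mul_left_comm, ← smul_eq_C_mul, map_smul, hLB, smul_eq_mul]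
  have hpos : B.PosDef := by
    refine .of_dotProduct_mulVec_pos ?_ fun v hv => ?_
    · ext i j
      simp [hB, add_comm]
    · have h0 : X * poly v ≠ 0 := by
        refine mul_ne_zero X_ne_zero fun h => hv ?_
        ext i
        rw [← hcoeff v i, h]; simp
      have := hL _ h0
      rw [sq, hLB' v _ (hdeg v)] at this
      simpa [dotProduct, hcoeff] using this
  have hdet := hpos.det_pos
  refine ⟨hdet, poly (B⁻¹.mulVec b), hdeg _, ?_⟩
  set q := poly (B⁻¹.mulVec b) with hq
  have horth : ∀ r : ℝ[X], r.natDegree ≤ n → L (X * q * (X * r)) = L (X * r) := by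
    intro r hr
    rw [hLB' _ _ hr, Matrix.mulVec_mulVec, Matrix.mul_nonsing_inv _ hdet.ne'.isUnit,
      Matrix.one_mulVec]
    conv_rhs => rw [r.as_sum_range_C_mul_X_pow' (Nat.lt_succ_of_le hr)]
    rw [Finset.sum_range]
    simp only [Finset.mul_sum, map_sum]
    refine Finset.sum_congr rfl fun i _ => ?_
    rw [mul_left_comm X, ← pow_succ', ← smul_eq_C_mul, map_smul, hc, smul_eq_mul]
  have hexp : ∀ r : ℝ[X], L ((1 - X * r) ^ 2) = L 1 - 2 * L (X * r) + L (X * r * (X * r)) := by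
    intro r
    have : (1 - X * r) ^ 2 = 1 - (2 : ℝ) • (X * r) + X * r * (X * r) := by
      rw [two_smul]; ring
    rw [this, map_add, map_sub, map_smul, smul_eq_mul]
  constructor
  · rw [Matrix.det_hankel_border c hc0 n hdet.ne'.isUnit, ← hB, ← hb, neg_neg,
      mul_div_cancel_left₀ _ hdet.ne', hexp, horth q (hdeg _), ← hLb]
    ring
  · intro r hr
    have h1 : 0 ≤ L ((X * (q - r)) ^ 2) := by
      by_cases h : X * (q - r) = 0
      · simp [h]
      · exact (hL _ h).le
    have h2 : (X * (q - r)) ^ 2 = X * q * (X * q) - (2 : ℝ) • (X * q * (X * r))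
        + X * r * (X * r) := by
      rw [two_smul]; ring
    rw [h2, map_add, map_sub, map_smul, smul_eq_mul, horth r hr, horth q (hdeg _)] at h1
    rw [hexp, hexp, horth q (hdeg _)]
    linarith

theorem integrableOn_pow_mul_exp_neg (n : ℕ) :
    IntegrableOn (fun x : ℝ => x ^ n * Real.exp (-x)) (Ioi 0) := by
  have := Real.GammaIntegral_convergent (s := n + 1) (by positivity)
  simpa [mul_comm] using this

theorem integral_pow_mul_exp_neg (n : ℕ) :
    ∫ x in Ioi (0 : ℝ), x ^ n * Real.exp (-x) = n.factorial := by
  have := Real.Gamma_eq_integral (s := n + 1) (by positivity)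
  rw [← Real.Gamma_nat_eq_factorial, this]
  simp [mul_comm]

theorem Polynomial.integrableOn_eval_mul_exp_neg (p : ℝ[X]) :
    IntegrableOn (fun x : ℝ => p.eval x * Real.exp (-x)) (Ioi 0) := by
  induction p using Polynomial.induction_on' with
  | add p q hp hq =>
    simp only [eval_add, add_mul]
    exact Integrable.add hp hq
  | monomial n c =>
    simp only [eval_monomial, mul_assoc]
    exact Integrable.const_mul (integrableOn_pow_mul_exp_neg n) c

/-- The functional `p ↦ ∫₀^∞ p(x) e^{-x} dx`. -/
noncomputable def expMoment : ℝ[X] →ₗ[ℝ] ℝ where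
  toFun p := ∫ x in Ioi (0 : ℝ), p.eval x * Real.exp (-x)
  map_add' p q := by
    simp only [eval_add, add_mul]
    exact integral_add p.integrableOn_eval_mul_exp_neg q.integrableOn_eval_mul_exp_neg
  map_smul' c p := by
    simp only [eval_smul, smul_eq_mul, mul_assoc, integral_const_mul, RingHom.id_apply]

theorem expMoment_apply (p : ℝ[X]) :
    expMoment p = ∫ x in Ioi (0 : ℝ), p.eval x * Real.exp (-x) := rfl

theorem expMoment_X_pow (n : ℕ) : expMoment (X ^ n) = n.factorial := by
  simpa [expMoment_apply] using integral_pow_mul_exp_neg n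

theorem expMoment_derivative (p : ℝ[X]) :
    expMoment (derivative p) = expMoment p - p.eval 0 := by
  induction p using Polynomial.induction_on' with
  | add p q hp hq => simp only [map_add, hp, hq, eval_add]; ring
  | monomial n c =>
    rw [← C_mul_X_pow_eq_monomial, derivative_C_mul_X_pow, ← smul_eq_C_mul, ← smul_eq_C_mul,
      map_smul, map_smul, expMoment_X_pow, expMoment_X_pow]
    rcases n with _ | n
    · simp
    · simp [Nat.factorial_succ]; ring

theorem Polynomial.integrableOn_eval_one_add_mul (p : ℝ[X]) :
    IntegrableOn (fun x : ℝ => p.eval (1 + x) * (Real.exp (-x) / (1 + x))) (Ioi 0) := by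
  have h := (p.comp (1 + X)).integrableOn_eval_mul_exp_neg
  refine Integrable.mono h ?_ ?_
  · refine ContinuousOn.aestronglyMeasurable ?_ measurableSet_Ioi
    have : ∀ x ∈ Ioi (0 : ℝ), 1 + x ≠ 0 := fun x hx => by
      have : 0 < x := hx
      positivity
    fun_prop (disch := assumption)
  · refine (ae_restrict_iff' measurableSet_Ioi).mpr (ae_of_all _ fun x (hx : 0 < x) => ?_)
    simp only [eval_comp, eval_add, eval_one, eval_X, norm_mul, norm_div, Real.norm_eq_abs]
    refine mul_le_mul_of_nonneg_left (div_le_self (abs_nonneg _) ?_) (abs_nonneg _)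
    exact le_abs.mpr (Or.inl (by linarith))

/-- The functional `p ↦ ∫₀^∞ p(1 + x) e^{-x} / (1 + x) dx`. -/
noncomputable def gompertzMoment : ℝ[X] →ₗ[ℝ] ℝ where
  toFun p := ∫ x in Ioi (0 : ℝ), p.eval (1 + x) * (Real.exp (-x) / (1 + x))
  map_add' p q := by
    simp only [eval_add, add_mul]
    exact integral_add p.integrableOn_eval_one_add_mul q.integrableOn_eval_one_add_mul
  map_smul' c p := by
    simp only [eval_smul, smul_eq_mul, mul_assoc, integral_const_mul, RingHom.id_apply]

theorem gompertzMoment_apply (p : ℝ[X]) :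
    gompertzMoment p = ∫ x in Ioi (0 : ℝ), p.eval (1 + x) * (Real.exp (-x) / (1 + x)) := rfl

theorem gompertzMoment_one :
    gompertzMoment 1 = ∫ x in Ici (0 : ℝ), Real.exp (-x) / (1 + x) := by
  simp [gompertzMoment_apply, integral_Ici_eq_integral_Ioi]

theorem gompertzMoment_X_mul (p : ℝ[X]) :
    gompertzMoment (X * p) = expMoment (p.comp (1 + X)) := by
  rw [gompertzMoment_apply, expMoment_apply]
  refine setIntegral_congr_fun measurableSet_Ioi fun x (hx : 0 < x) => ?_
  have : 1 + x ≠ 0 := by positivity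
  simp
  field_simp

theorem gompertzMoment_X_pow_succ (n : ℕ) :
    gompertzMoment (X ^ (n + 1)) =
      ∑ i ∈ Finset.range (n + 1), (n.factorial : ℝ) / (i.factorial : ℝ) := by
  rw [pow_succ', gompertzMoment_X_mul, X_pow_comp, add_comm, add_pow, map_sum]
  rw [← Finset.sum_range_reflect]
  refine Finset.sum_congr rfl fun i hi => ?_
  have hi : i ≤ n := Nat.lt_succ_iff.mp (Finset.mem_range.mp hi)
  have e : n + 1 - 1 - i = n - i := by omega
  rw [e, one_pow, mul_one, ← C_eq_natCast, mul_comm, ← smul_eq_C_mul, map_smul, expMoment_X_pow,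
    Nat.choose_symm hi, Nat.cast_choose ℝ hi, smul_eq_mul]
  field_simp

theorem gompertzMoment_sq_pos (p : ℝ[X]) (hp : p ≠ 0) : 0 < gompertzMoment (p ^ 2) := by
  rw [gompertzMoment_apply, setIntegral_pos_iff_support_of_nonneg_ae _
    (p ^ 2).integrableOn_eval_one_add_mul]
  · have hfin : {x : ℝ | p.eval (1 + x) = 0}.Finite := by
      refine Set.Finite.subset ((p.comp (1 + X)).roots.toFinset.finite_toSet) fun x hx => ?_
      have hne : p.comp (1 + X) ≠ 0 := by
        rw [add_comm, ← C_1]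
        exact fun h => hp ((comp_X_add_C_eq_zero_iff).mp h)
      simpa [hne] using hx
    have hsub : Ioi (0 : ℝ) \ {x : ℝ | p.eval (1 + x) = 0} ⊆
        Function.support (fun x : ℝ => (p ^ 2).eval (1 + x) * (Real.exp (-x) / (1 + x)))
          ∩ Ioi 0 := by
      rintro x ⟨hx : 0 < x, hx'⟩
      refine ⟨?_, hx⟩
      have : 1 + x ≠ 0 := by positivity
      simp_all [Real.exp_ne_zero]
    refine lt_of_lt_of_le ?_ (measure_mono hsub)
    rw [measure_sdiff_null (hfin.measure_zero _)]
    simp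
  · refine (ae_restrict_iff' measurableSet_Ioi).mpr (ae_of_all _ fun x (hx : 0 < x) => ?_)
    simp only [eval_pow, Pi.zero_apply]
    positivity

theorem gompertzMoment_sq_le (p : ℝ[X]) :
    gompertzMoment (p ^ 2) ≤ expMoment ((p.comp (1 + X)) ^ 2) := by
  rw [gompertzMoment_apply, expMoment_apply]
  refine setIntegral_mono_on (p ^ 2).integrableOn_eval_one_add_mul
    (integrableOn_eval_mul_exp_neg _) measurableSet_Ioi fun x (hx : 0 < x) => ?_
  simp only [eval_pow, eval_comp, eval_add, eval_one, eval_X]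
  exact mul_le_mul_of_nonneg_left (div_le_self (Real.exp_pos _).le (by linarith)) (sq_nonneg _)

/-- The `n`-th Laguerre polynomial. -/
noncomputable def laguerre (n : ℕ) : ℝ[X] :=
  ∑ j ∈ Finset.range (n + 1), C ((-1) ^ j * (n.choose j : ℝ) / (j.factorial : ℝ)) * X ^ j

theorem laguerre_coeff (n j : ℕ) :
    (laguerre n).coeff j = (-1) ^ j * (n.choose j : ℝ) / (j.factorial : ℝ) := by
  simp only [laguerre, finsetSum_coeff, coeff_C_mul, coeff_X_pow]
  rw [Finset.sum_eq_single j]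
  · simp
  · intro i _ hi
    simp [hi.symm]
  · intro hj
    have : n < j := by simpa using hj
    simp [Nat.choose_eq_zero_of_lt this]

theorem laguerre_natDegree_le (n : ℕ) : (laguerre n).natDegree ≤ n :=
  natDegree_sum_le_of_forall_le _ _ fun _ hi =>
    (natDegree_C_mul_X_pow_le _ _).trans (Nat.lt_succ_iff.mp (Finset.mem_range.mp hi))

theorem laguerre_eval_zero (n : ℕ) : (laguerre n).eval 0 = 1 := by
  rw [← coeff_zero_eq_eval_zero, laguerre_coeff]
  simp

theorem derivative_laguerre_sub (n : ℕ) :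
    derivative (laguerre n - laguerre (n + 1)) = laguerre n := by
  ext j
  rw [coeff_derivative, coeff_sub, laguerre_coeff, laguerre_coeff, laguerre_coeff,
    Nat.choose_succ_succ, Nat.factorial_succ]
  push_cast
  field_simp
  ring

theorem expMoment_laguerre_sq (n : ℕ) : expMoment (laguerre n ^ 2) = 1 := by
  induction n with
  | zero => simpa [laguerre] using expMoment_X_pow 0
  | succ n ih =>
    set F := laguerre n - laguerre (n + 1) with hF
    have hd : derivative F = laguerre n := derivative_laguerre_sub n
    have h0 : F.eval 0 = 0 := by simp [hF, laguerre_eval_zero]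
    have h1 : laguerre (n + 1) ^ 2 = laguerre n ^ 2 - derivative (F ^ 2) + F ^ 2 := by
      have : laguerre (n + 1) = laguerre n - F := by rw [hF]; ring
      rw [this, derivative_sq, hd, C_ofNat]
      ring
    rw [h1, map_add, map_sub, expMoment_derivative, ih]
    simp [h0]

theorem laguerre_eval_neg_one (n : ℕ) : (n : ℝ) + 1 ≤ (laguerre n).eval (-1) := by
  have h : (laguerre n).eval (-1) =
      ∑ j ∈ Finset.range (n + 1), (n.choose j : ℝ) / (j.factorial : ℝ) := by
    simp only [laguerre, eval_finsetSum]
    refine Finset.sum_congr rfl fun j _ => ?_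
    have : (-1 : ℝ) ^ j * (-1) ^ j = 1 := by rw [← mul_pow]; simp
    simp only [eval_mul, eval_C, eval_pow, eval_X]
    linear_combination ((n.choose j : ℝ) / (j.factorial : ℝ)) * this
  rcases n with _ | n
  · simp [h]
  rw [h]
  have := Finset.sum_le_sum_of_subset_of_nonneg
    (f := fun j => ((n + 1).choose j : ℝ) / (j.factorial : ℝ))
    (Finset.range_mono (show 2 ≤ n + 1 + 1 by omega)) fun i _ _ => by positivity
  refine le_trans ?_ this
  simp [Finset.sum_range_succ]
  linarith

theorem exists_gompertzMoment_sq_le (n : ℕ) :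
    ∃ r : ℝ[X], r.natDegree ≤ n ∧ gompertzMoment ((1 - X * r) ^ 2) ≤ 1 / ((n : ℝ) + 1) := by
  set s := (laguerre n).eval (-1) with hs
  have hn : (n : ℝ) + 1 ≤ s := laguerre_eval_neg_one n
  have hn0 : (0 : ℝ) ≤ n := n.cast_nonneg
  have hs0 : s ≠ 0 := by linarith
  set p := C s⁻¹ * (laguerre n).comp (X - 1) with hp
  have hp0 : (1 - p).coeff 0 = 0 := by
    rw [coeff_zero_eq_eval_zero]
    simp [hp, ← hs, hs0]
  have hpd : p.natDegree ≤ n := by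
    refine (natDegree_C_mul_le _ _).trans (natDegree_comp_le.trans ?_)
    rw [← C_1, natDegree_X_sub_C, mul_one]
    exact laguerre_natDegree_le n
  refine ⟨(1 - p).divX, ?_, ?_⟩
  · rw [natDegree_divX_eq_natDegree_tsub_one]
    refine (Nat.sub_le _ _).trans ((natDegree_sub_le _ _).trans ?_)
    simpa using hpd
  · have h1 : 1 - X * (1 - p).divX = p := by
      have := X_mul_divX_add (1 - p)
      rw [hp0, C_0, add_zero] at this
      rw [this]; ring
    rw [h1]
    refine (gompertzMoment_sq_le p).trans ?_
    have h2 : p.comp (1 + X) ^ 2 = ((s⁻¹) ^ 2) • laguerre n ^ 2 := by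
      rw [hp, mul_comp, C_comp, comp_assoc, smul_eq_C_mul, mul_pow, C_pow]
      simp
    rw [h2, map_smul, expMoment_laguerre_sq, smul_eq_mul, mul_one, inv_pow, one_div]
    refine inv_anti₀ (by positivity) (hn.trans ?_)
    nlinarith

/-- **Rational approximations of the Euler–Gompertz constant.** Set `a 0 := 0` and, for
`n ≥ 1`, `a n := Σ_{i=0}^{n-1} (n-1)!/i!`, and define the Hankel determinants
`P n := -det (a_{i+j})_{i,j=0}^{n+1}` and `Q n := det (a_{i+j+2})_{i,j=0}^{n}`. Then for every
`n`: `Q n > 0`, `0 < P n / Q n < δ`, `P n / Q n ≤ P (n+1) / Q (n+1)`, and `P n / Q n → δ`,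
where `δ := ∫_0^∞ e^{-x}/(1+x) dx` is the Euler–Gompertz constant. -/
theorem stmt_11 (a : ℕ → ℝ) (ha0 : a 0 = 0)
    (ha : ∀ n : ℕ, 1 ≤ n →
      a n = ∑ i ∈ Finset.range n, ((Nat.factorial (n - 1) : ℝ) / (Nat.factorial i : ℝ)))
    (δ : ℝ) (hδ : δ = ∫ x in Ici (0 : ℝ), Real.exp (-x) / (1 + x))
    (P Q : ℕ → ℝ)
    (hP : ∀ n : ℕ, P n = -Matrix.det (Matrix.of fun i j : Fin (n + 2) => a (i.val + j.val)))
    (hQ : ∀ n : ℕ, Q n = Matrix.det (Matrix.of fun i j : Fin (n + 1) => a (i.val + j.val + 2))) :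
    (∀ n : ℕ, 0 < Q n) ∧
      (∀ n : ℕ, 0 < P n / Q n ∧ P n / Q n < δ) ∧
      (∀ n : ℕ, P n / Q n ≤ P (n + 1) / Q (n + 1)) ∧
      Tendsto (fun n : ℕ => P n / Q n) atTop (nhds δ) := by
  have hc : ∀ n, gompertzMoment (X ^ (n + 1)) = a (n + 1) := fun n => by
    rw [gompertzMoment_X_pow_succ, ha (n + 1) n.succ_pos, Nat.add_sub_cancel]
  have hδ' : gompertzMoment 1 = δ := by rw [gompertzMoment_one, hδ]
  have key : ∀ n, 0 < Q n ∧ ∃ q : ℝ[X], q.natDegree ≤ n ∧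
      δ - P n / Q n = gompertzMoment ((1 - X * q) ^ 2) ∧
      ∀ r : ℝ[X], r.natDegree ≤ n →
        gompertzMoment ((1 - X * q) ^ 2) ≤ gompertzMoment ((1 - X * r) ^ 2) := fun n => by
    rw [hP, hQ, ← hδ']
    exact exists_minimizer_hankel_quotient gompertzMoment gompertzMoment_sq_pos a ha0 hc n
  have hlt : ∀ n, P n / Q n < δ := fun n => by
    obtain ⟨-, q, -, hq, -⟩ := key n
    have hne : (1 : ℝ[X]) - X * q ≠ 0 := fun h => by
      simpa using congrArg (eval 0) h
    linarith [gompertzMoment_sq_pos _ hne]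
  have hmono : ∀ n, P n / Q n ≤ P (n + 1) / Q (n + 1) := fun n => by
    obtain ⟨-, q, hqd, hq, -⟩ := key n
    obtain ⟨-, q', -, hq', hmin⟩ := key (n + 1)
    linarith [hmin q (hqd.trans n.le_succ)]
  have hzero : 0 < P 0 / Q 0 := by
    have h1 : a 1 = 1 := by simp [ha 1 le_rfl]
    refine div_pos ?_ (key 0).1
    rw [hP, Matrix.det_fin_two]
    simp [ha0, h1]
  refine ⟨fun n => (key n).1, fun n => ⟨?_, hlt n⟩, hmono, ?_⟩
  · exact hzero.trans_le (monotone_nat_of_le_succ (f := fun n => P n / Q n) hmono n.zero_le)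
  · have hlow : ∀ n : ℕ, δ - 1 / ((n : ℝ) + 1) ≤ P n / Q n := fun n => by
      obtain ⟨-, q, -, hq, hmin⟩ := key n
      obtain ⟨r, hrd, hr⟩ := exists_gompertzMoment_sq_le n
      linarith [hmin r hrd]
    refine tendsto_of_tendsto_of_tendsto_of_le_of_le ?_ tendsto_const_nhds hlow
      fun n => (hlt n).le
    simpa using (tendsto_one_div_add_atTop_nhds_zero_nat (𝕜 := ℝ)).const_sub δ
end

section
/- Let k ≥ 2 be an integer. Set a_0 := 0 and, for n ≥ 1, a_n := Σ_{i=0}^{n-1} C(n−1,i)·(−1)^i/(i+1)^k, and define the Hankel determinants P_n := -det((a_{i+j})_{i,j=0}^{n+1}) and Q_n := det((a_{i+j+2})_{i,j=0}^{n}). Then for every n ≥ 0: Q_n > 0, 0 < P_n/Q_n < ζ(k), P_n/Q_n ≤ P_{n+1}/Q_{n+1}, and lim_{n→∞} P_n/Q_n = ζ(k), where ζ(k) := Σ_{m=1}^∞ 1/m^k. -/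
open Filter

open Polynomial in
/-- The `n × n` Hankel matrix of the moments `L (X ^ m)` of a linear functional `L`. -/
noncomputable def hankelMatrix (L : ℝ[X] →ₗ[ℝ] ℝ) (n : ℕ) : Matrix (Fin n) (Fin n) ℝ :=
  Matrix.of fun i j => L (X ^ (i.val + j.val))

section Hankel

open Polynomial Matrix

variable {L : ℝ[X] →ₗ[ℝ] ℝ}

lemma dotProduct_hankelMatrix_mulVec (L : ℝ[X] →ₗ[ℝ] ℝ) (n : ℕ) (v w : Fin n → ℝ) :
    v ⬝ᵥ hankelMatrix L n *ᵥ w = L (ofFn n v * ofFn n w) := by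
  simp only [ofFn_eq_sum_monomial, Finset.sum_mul, map_sum, dotProduct, mulVec, hankelMatrix,
    of_apply, Finset.mul_sum]
  rw [Finset.sum_comm]
  refine Finset.sum_congr rfl fun j _ => Finset.sum_congr rfl fun i _ => ?_
  rw [monomial_mul_monomial, ← C_mul_X_pow_eq_monomial, ← smul_eq_C_mul, map_smul, smul_eq_mul]
  ring

lemma posDef_hankelMatrix (hL : ∀ p : ℝ[X], p ≠ 0 → 0 < L (p * p)) (n : ℕ) :
    (hankelMatrix L n).PosDef := by
  refine PosDef.of_dotProduct_mulVec_pos ?_ fun v hv => ?_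
  · ext i j
    simp [hankelMatrix, add_comm]
  · rw [star_trivial, dotProduct_hankelMatrix_mulVec]
    exact hL _ fun h => hv (injective_ofFn n (h.trans (ofFn_zero n).symm))

/-- Among polynomials of degree at most `n` with constant coefficient `1`, the minimum of
`p ↦ L (p * p)` is a ratio of Hankel determinants. -/
lemma exists_isMin_hankelMatrix_det_div (hL : ∀ p : ℝ[X], p ≠ 0 → 0 < L (p * p)) (n : ℕ) :
    ∃ p : ℝ[X], p.natDegree < n + 1 ∧ p.coeff 0 = 1 ∧
      L (p * p) = (hankelMatrix L (n + 1)).det /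
        ((hankelMatrix L (n + 1)).submatrix Fin.succ Fin.succ).det ∧
      ∀ q : ℝ[X], q.natDegree < n + 1 → q.coeff 0 = 1 → L (p * p) ≤ L (q * q) := by
  set H := hankelMatrix L (n + 1) with hH
  set B := H.submatrix Fin.succ Fin.succ with hB
  have hBpos : 0 < B.det :=
    ((posDef_hankelMatrix hL (n + 1)).submatrix (Fin.succ_injective n)).det_pos
  set w : Fin (n + 1) → ℝ := B.det⁻¹ • (H.cramer (Pi.single 0 1)) with hw
  have hw0 : w 0 = 1 := by
    have : H.cramer (Pi.single 0 1) 0 = B.det := by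
      have := adjugate_fin_succ_eq_det_submatrix H 0 0
      simpa [cramer_eq_adjugate_mulVec, hB] using this
    simp [hw, this, hBpos.ne']
  have hHw : H *ᵥ w = Pi.single 0 (H.det / B.det) := by
    rw [hw, mulVec_smul, mulVec_cramer]
    ext i
    refine Fin.cases ?_ (fun j => ?_) i
    · simp; ring
    · simp
  have key : ∀ q : ℝ[X], q.natDegree < n + 1 → q.coeff 0 = 1 →
      L (q * ofFn (n + 1) w) = H.det / B.det := by
    intro q hq hq0
    rw [← ofFn_comp_toFn_eq_id_of_natDegree_lt hq, ← dotProduct_hankelMatrix_mulVec, ← hH, hHw]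
    simp [toFn, hq0]
  have hwd : (ofFn (n + 1) w).natDegree < n + 1 := ofFn_natDegree_lt (by omega) w
  have hwc : (ofFn (n + 1) w).coeff 0 = 1 := by
    rw [ofFn_coeff_eq_val_of_lt w (Nat.succ_pos n)]
    exact hw0
  refine ⟨ofFn (n + 1) w, hwd, hwc, key _ hwd hwc, fun q hq hq0 => ?_⟩
  have hnn : 0 ≤ L ((q - ofFn (n + 1) w) * (q - ofFn (n + 1) w)) := by
    by_cases h : q - ofFn (n + 1) w = 0
    · simp [h]
    · exact (hL _ h).le
  have hexp : (q - ofFn (n + 1) w) * (q - ofFn (n + 1) w) =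
      q * q - (q * ofFn (n + 1) w + q * ofFn (n + 1) w) + ofFn (n + 1) w * ofFn (n + 1) w := by
    ring
  rw [hexp, map_add, map_sub, map_add, key q hq hq0, key _ hwd hwc] at hnn
  rw [key _ hwd hwc]
  linarith

/-- Changing the top left entry of a square matrix changes its determinant linearly. -/
lemma det_eq_det_add_mul_det_submatrix {R : Type*} [CommRing R] {n : ℕ}
    (A B : Matrix (Fin (n + 1)) (Fin (n + 1)) R) (h : ∀ i j, (i, j) ≠ (0, 0) → A i j = B i j) :
    A.det = B.det + (A 0 0 - B 0 0) * (B.submatrix Fin.succ Fin.succ).det := by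
  have hsub : ∀ f : Fin n → Fin (n + 1), A.submatrix Fin.succ f = B.submatrix Fin.succ f := by
    intro f
    ext i j
    exact h _ _ (by simp)
  rw [det_succ_row_zero A, det_succ_row_zero B, Fin.sum_univ_succ, Fin.sum_univ_succ]
  have hA : ∀ j : Fin n, A 0 j.succ = B 0 j.succ := fun j => h _ _ (by simp)
  simp only [hsub, hA, Fin.succAbove_zero, Fin.val_zero, pow_zero, one_mul]
  ring

end Hankel

section Zeta

open MeasureTheory Set Polynomial

lemma integral_pow_mul_exp_neg_mul_Ioi (j : ℕ) {c : ℝ} (hc : 0 < c) :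
    ∫ s in Ioi (0 : ℝ), s ^ j / (j.factorial : ℝ) * Real.exp (-(c * s)) = 1 / c ^ (j + 1) := by
  have h := Real.integral_rpow_mul_exp_neg_mul_Ioi (a := (j : ℝ) + 1) (r := c) (by positivity) hc
  rw [Real.Gamma_nat_eq_factorial] at h
  have h1 : ∀ s : ℝ, s ^ j / (j.factorial : ℝ) * Real.exp (-(c * s)) =
      (j.factorial : ℝ)⁻¹ * (s ^ ((j : ℝ) + 1 - 1) * Real.exp (-(c * s))) := by
    intro s
    rw [add_sub_cancel_right, Real.rpow_natCast]
    ring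
  have hj : (j.factorial : ℝ) ≠ 0 := by positivity
  simp_rw [h1]
  rw [integral_const_mul, h, show (j : ℝ) + 1 = ((j + 1 : ℕ) : ℝ) by push_cast; rfl,
    Real.rpow_natCast, one_div_pow]
  field_simp

lemma integrableOn_pow_mul_exp_neg_mul_Ioi (j : ℕ) {c : ℝ} (hc : 0 < c) :
    IntegrableOn (fun s : ℝ => s ^ j / (j.factorial : ℝ) * Real.exp (-(c * s))) (Ioi 0) := by
  by_contra h
  have h1 := integral_pow_mul_exp_neg_mul_Ioi j hc
  rw [integral_undef h] at h1
  have : 0 < 1 / c ^ (j + 1) := by positivity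
  linarith

/-- The weight `s ^ j / (j! (e ^ s - 1))` whose integral over `(0, ∞)` is `ζ(j + 1)`. -/
noncomputable def zetaWeight (j : ℕ) (s : ℝ) : ℝ :=
  s ^ j / (j.factorial : ℝ) * (Real.exp s - 1)⁻¹

lemma zetaWeight_pos (j : ℕ) {s : ℝ} (hs : 0 < s) : 0 < zetaWeight j s := by
  have : 0 < Real.exp s - 1 := sub_pos.2 (Real.one_lt_exp_iff.2 hs)
  unfold zetaWeight
  positivity

lemma summable_one_div_add_one_pow {j : ℕ} (hj : 1 ≤ j) :
    Summable fun m : ℕ => 1 / ((m : ℝ) + 1) ^ (j + 1) := by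
  have := (summable_nat_add_iff 1).2 (Real.summable_one_div_nat_pow (p := j + 1).2 (by omega))
  simpa using this

lemma integral_zetaWeight {j : ℕ} (hj : 1 ≤ j) :
    ∫ s in Ioi (0 : ℝ), zetaWeight j s = ∑' m : ℕ, 1 / ((m : ℝ) + 1) ^ (j + 1) := by
  have hF : ∀ m : ℕ, ∫ s in Ioi (0 : ℝ),
      ‖s ^ j / (j.factorial : ℝ) * Real.exp (-(((m : ℝ) + 1) * s))‖ =
        1 / ((m : ℝ) + 1) ^ (j + 1) := by
    intro m
    rw [← integral_pow_mul_exp_neg_mul_Ioi j (by positivity : (0 : ℝ) < (m : ℝ) + 1)]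
    refine setIntegral_congr_fun measurableSet_Ioi fun s hs => ?_
    have hs : 0 < s := hs
    exact Real.norm_of_nonneg (by positivity)
  have h := hasSum_integral_of_summable_integral_norm (μ := volume.restrict (Ioi (0 : ℝ)))
    (F := fun (m : ℕ) s => s ^ j / (j.factorial : ℝ) * Real.exp (-(((m : ℝ) + 1) * s)))
    (fun m => integrableOn_pow_mul_exp_neg_mul_Ioi j (by positivity))
    (by simpa only [hF] using summable_one_div_add_one_pow hj)
  simp only [integral_pow_mul_exp_neg_mul_Ioi j (Nat.cast_add_one_pos _)] at h
  rw [h.tsum_eq]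
  refine setIntegral_congr_fun measurableSet_Ioi fun s hs => ?_
  have hs : 0 < s := hs
  have hlt : Real.exp (-s) < 1 := Real.exp_lt_one_iff.2 (by linarith)
  have hterm : ∀ m : ℕ, Real.exp (-(((m : ℝ) + 1) * s)) =
      Real.exp (-s) * Real.exp (-s) ^ m := by
    intro m
    rw [← Real.exp_nat_mul, ← Real.exp_add]
    ring_nf
  simp only [hterm, tsum_mul_left]
  rw [tsum_geometric_of_lt_one (Real.exp_pos _).le hlt, zetaWeight]
  have h1 : (1 : ℝ) - Real.exp (-s) ≠ 0 := by linarith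
  have h2 : Real.exp s - 1 ≠ 0 := (sub_pos.2 (Real.one_lt_exp_iff.2 hs)).ne'
  have h3 : Real.exp (-s) * Real.exp s = 1 := by rw [← Real.exp_add]; simp
  congr 1
  field_simp
  linarith

lemma integrableOn_zetaWeight {j : ℕ} (hj : 1 ≤ j) : IntegrableOn (zetaWeight j) (Ioi 0) := by
  by_contra h
  have h1 := integral_zetaWeight hj
  rw [integral_undef h] at h1
  have h2 := (summable_one_div_add_one_pow hj).tsum_pos (fun m => by positivity) 0 (by simp)
  linarith

lemma integrableOn_eval_mul_zetaWeight {j : ℕ} (hj : 1 ≤ j) (p : ℝ[X]) :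
    IntegrableOn (fun s => p.eval (1 - Real.exp (-s)) * zetaWeight j s) (Ioi 0) := by
  obtain ⟨C, hC⟩ := (isCompact_Icc (a := (0 : ℝ)) (b := 1)).exists_bound_of_continuousOn
    p.continuous.continuousOn
  refine (integrableOn_zetaWeight hj).bdd_mul (c := C) ?_ ?_
  · exact (p.continuous.comp
      (by fun_prop : Continuous fun s : ℝ => 1 - Real.exp (-s))).aestronglyMeasurable
  · refine (ae_restrict_mem measurableSet_Ioi).mono fun s hs => hC _ ?_
    have hs : 0 < s := hs
    have hlt : Real.exp (-s) < 1 := Real.exp_lt_one_iff.2 (by linarith)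
    have := Real.exp_pos (-s)
    constructor <;> linarith

/-- Integration of polynomials in `1 - e ^ (-s)` against the weight `zetaWeight`. -/
noncomputable def zetaFunctional {j : ℕ} (hj : 1 ≤ j) : ℝ[X] →ₗ[ℝ] ℝ where
  toFun p := ∫ s in Ioi (0 : ℝ), p.eval (1 - Real.exp (-s)) * zetaWeight j s
  map_add' p q := by
    simp only [eval_add, add_mul]
    exact integral_add (integrableOn_eval_mul_zetaWeight hj p)
      (integrableOn_eval_mul_zetaWeight hj q)
  map_smul' c p := by
    simp only [eval_smul, smul_eq_mul, mul_assoc, RingHom.id_apply]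
    exact integral_const_mul _ _

lemma zetaFunctional_apply {j : ℕ} (hj : 1 ≤ j) (p : ℝ[X]) :
    zetaFunctional hj p = ∫ s in Ioi (0 : ℝ), p.eval (1 - Real.exp (-s)) * zetaWeight j s :=
  rfl

lemma zetaFunctional_mul_self_pos {j : ℕ} (hj : 1 ≤ j) (p : ℝ[X]) (hp : p ≠ 0) :
    0 < zetaFunctional hj (p * p) := by
  rw [zetaFunctional_apply, setIntegral_pos_iff_support_of_nonneg_ae _
    (integrableOn_eval_mul_zetaWeight hj _)]
  · have hfin : ((fun s : ℝ => 1 - Real.exp (-s)) ⁻¹' p.rootSet ℝ).Finite := by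
      refine (p.rootSet_finite ℝ).preimage (Function.Injective.injOn fun s t h => ?_)
      simpa using h
    have hsub : Ioi (0 : ℝ) \ ((fun s : ℝ => 1 - Real.exp (-s)) ⁻¹' p.rootSet ℝ) ⊆
        (Function.support fun s => (p * p).eval (1 - Real.exp (-s)) * zetaWeight j s) ∩ Ioi 0 := by
      rintro s ⟨hs, hr⟩
      refine ⟨?_, hs⟩
      have h0 : p.eval (1 - Real.exp (-s)) ≠ 0 := fun h =>
        hr ((mem_rootSet_of_ne hp).2 (by simpa using h))
      have := (zetaWeight_pos j hs).ne'
      simp [h0, this]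
    refine lt_of_lt_of_le ?_ (measure_mono hsub)
    rw [measure_sdiff_null (hfin.measure_zero _)]
    simp
  · refine (ae_restrict_mem measurableSet_Ioi).mono fun s hs => ?_
    simp only [eval_mul]
    exact mul_nonneg (mul_self_nonneg _) (zetaWeight_pos j hs).le

lemma zetaFunctional_one {j : ℕ} (hj : 1 ≤ j) :
    zetaFunctional hj 1 = ∑' m : ℕ, 1 / ((m : ℝ) + 1) ^ (j + 1) := by
  rw [← integral_zetaWeight hj]
  simp [zetaFunctional_apply]

lemma zetaFunctional_X_pow_succ {j : ℕ} (hj : 1 ≤ j) (n : ℕ) :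
    zetaFunctional hj (X ^ (n + 1)) =
      ∑ i ∈ Finset.range (n + 1), (n.choose i : ℝ) * (-1 : ℝ) ^ i / ((i : ℝ) + 1) ^ (j + 1) := by
  have hcongr : ∀ s ∈ Ioi (0 : ℝ), (X ^ (n + 1) : ℝ[X]).eval (1 - Real.exp (-s)) * zetaWeight j s =
      ∑ i ∈ Finset.range (n + 1), (n.choose i : ℝ) * (-1 : ℝ) ^ i *
        (s ^ j / (j.factorial : ℝ) * Real.exp (-(((i : ℝ) + 1) * s))) := by
    intro s hs
    have hs : 0 < s := hs
    have h2 : Real.exp s - 1 ≠ 0 := (sub_pos.2 (Real.one_lt_exp_iff.2 hs)).ne'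
    have h3 : Real.exp (-s) * Real.exp s = 1 := by rw [← Real.exp_add]; simp
    have h4 : (1 - Real.exp (-s)) * (Real.exp s - 1)⁻¹ = Real.exp (-s) := by
      field_simp
      linarith
    have hpow : (1 - Real.exp (-s)) ^ n = ∑ i ∈ Finset.range (n + 1),
        (n.choose i : ℝ) * (-1 : ℝ) ^ i * Real.exp (-s) ^ i := by
      rw [sub_eq_neg_add, add_pow]
      refine Finset.sum_congr rfl fun i _ => ?_
      rw [neg_pow, one_pow]
      ring
    calc (X ^ (n + 1) : ℝ[X]).eval (1 - Real.exp (-s)) * zetaWeight j s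
        = (1 - Real.exp (-s)) ^ n * (s ^ j / (j.factorial : ℝ)) *
            ((1 - Real.exp (-s)) * (Real.exp s - 1)⁻¹) := by
          rw [eval_pow, eval_X, zetaWeight]
          ring
      _ = _ := by
          rw [h4, hpow, Finset.sum_mul, Finset.sum_mul]
          refine Finset.sum_congr rfl fun i _ => ?_
          rw [show -(((i : ℝ) + 1) * s) = (i : ℝ) * -s + -s by ring, Real.exp_add,
            Real.exp_nat_mul]
          ring
  rw [zetaFunctional_apply, setIntegral_congr_fun measurableSet_Ioi hcongr, integral_finsetSum]
  · refine Finset.sum_congr rfl fun i _ => ?_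
    rw [integral_const_mul, integral_pow_mul_exp_neg_mul_Ioi j (Nat.cast_add_one_pos _)]
    ring
  · exact fun i _ => (integrableOn_pow_mul_exp_neg_mul_Ioi j (Nat.cast_add_one_pos _)).const_mul _

lemma tendsto_zetaFunctional_one_sub_X_pow {j : ℕ} (hj : 1 ≤ j) :
    Filter.Tendsto (fun n : ℕ => zetaFunctional hj ((1 - X) ^ n * (1 - X) ^ n)) Filter.atTop
      (nhds 0) := by
  have h := tendsto_integral_of_dominated_convergence (μ := volume.restrict (Ioi (0 : ℝ)))
    (F := fun (n : ℕ) s =>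
      ((1 - X : ℝ[X]) ^ n * (1 - X) ^ n).eval (1 - Real.exp (-s)) * zetaWeight j s)
    (f := fun _ => 0) (zetaWeight j)
    (fun n => (integrableOn_eval_mul_zetaWeight hj _).aestronglyMeasurable)
    (integrableOn_zetaWeight hj) (fun n => ?_) ?_
  · rw [integral_zero] at h
    exact h
  · refine (ae_restrict_mem measurableSet_Ioi).mono fun s hs => ?_
    have hw := zetaWeight_pos j hs
    have hs : 0 < s := hs
    have hlt : Real.exp (-s) < 1 := Real.exp_lt_one_iff.2 (by linarith)
    have h1 : Real.exp (-s) ^ n * Real.exp (-s) ^ n ≤ 1 :=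
      mul_le_one₀ (pow_le_one₀ (Real.exp_pos _).le hlt.le) (by positivity)
        (pow_le_one₀ (Real.exp_pos _).le hlt.le)
    simp only [eval_mul, eval_pow, eval_sub, eval_one, eval_X, sub_sub_cancel]
    rw [Real.norm_of_nonneg (by positivity)]
    exact mul_le_of_le_one_left hw.le h1
  · refine (ae_restrict_mem measurableSet_Ioi).mono fun s hs => ?_
    have hs : 0 < s := hs
    have hlt : Real.exp (-s) < 1 := Real.exp_lt_one_iff.2 (by linarith)
    have ht := tendsto_pow_atTop_nhds_zero_of_lt_one (Real.exp_pos (-s)).le hlt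
    simpa only [eval_mul, eval_pow, eval_sub, eval_one, eval_X, sub_sub_cancel, mul_zero,
      zero_mul] using (ht.mul ht).mul_const (zetaWeight j s)

end Zeta

/-- **Rational approximations of the zeta values.** Let `k ≥ 2`. Set `a 0 := 0` and, for
`n ≥ 1`, `a n := Σ_{i=0}^{n-1} C(n-1,i) (-1)^i/(i+1)^k`, and define the Hankel determinants
`P n := -det (a_{i+j})_{i,j=0}^{n+1}` and `Q n := det (a_{i+j+2})_{i,j=0}^{n}`. Then for every
`n`: `Q n > 0`, `0 < P n / Q n < ζ(k)`, `P n / Q n ≤ P (n+1) / Q (n+1)`, and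
`P n / Q n → ζ(k)`, where `ζ(k) := Σ_{m=1}^∞ 1/m^k`. -/
theorem stmt_14 (k : ℕ) (hk : 2 ≤ k) (a : ℕ → ℝ) (ha0 : a 0 = 0)
    (ha : ∀ n : ℕ, 1 ≤ n →
      a n = ∑ i ∈ Finset.range n, ((n - 1).choose i : ℝ) * (-1 : ℝ) ^ i / ((i : ℝ) + 1) ^ k)
    (z : ℝ) (hz : z = ∑' m : ℕ, 1 / ((m : ℝ) + 1) ^ k)
    (P Q : ℕ → ℝ)
    (hP : ∀ n : ℕ, P n = -Matrix.det (Matrix.of fun i j : Fin (n + 2) => a (i.val + j.val)))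
    (hQ : ∀ n : ℕ, Q n = Matrix.det (Matrix.of fun i j : Fin (n + 1) => a (i.val + j.val + 2))) :
    (∀ n : ℕ, 0 < Q n) ∧
      (∀ n : ℕ, 0 < P n / Q n ∧ P n / Q n < z) ∧
      (∀ n : ℕ, P n / Q n ≤ P (n + 1) / Q (n + 1)) ∧
      Tendsto (fun n : ℕ => P n / Q n) atTop (nhds z) := by
  obtain ⟨j, rfl⟩ : ∃ j, k = j + 1 := ⟨k - 1, by omega⟩
  have hj : 1 ≤ j := by omega
  set L := zetaFunctional hj with hLdef
  have hL : ∀ p : Polynomial ℝ, p ≠ 0 → 0 < L (p * p) := zetaFunctional_mul_self_pos hj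
  have hz' : L 1 = z := (zetaFunctional_one hj).trans hz.symm
  have haL : ∀ n : ℕ, L (Polynomial.X ^ (n + 1)) = a (n + 1) := fun n => by
    rw [ha _ n.succ_pos, hLdef, zetaFunctional_X_pow_succ hj n]
    rfl
  have hsub : ∀ n : ℕ, ((hankelMatrix L (n + 2)).submatrix Fin.succ Fin.succ).det = Q n := by
    intro n
    rw [hQ]
    congr 1
    ext i l
    simp only [hankelMatrix, Matrix.submatrix_apply, Matrix.of_apply, Fin.val_succ]
    rw [show i.val + 1 + (l.val + 1) = i.val + l.val + 1 + 1 by ring, haL]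
  have hQpos : ∀ n : ℕ, 0 < Q n := fun n => by
    rw [← hsub]
    exact ((posDef_hankelMatrix hL (n + 2)).submatrix (Fin.succ_injective _)).det_pos
  have hdet : ∀ n : ℕ, (hankelMatrix L (n + 2)).det / Q n = z - P n / Q n := by
    intro n
    have h := det_eq_det_add_mul_det_submatrix
      (Matrix.of fun i j : Fin (n + 2) => a (i.val + j.val)) (hankelMatrix L (n + 2)) (by
        intro i l hil
        obtain ⟨m, hm⟩ : ∃ m, i.val + l.val = m + 1 := by
          refine Nat.exists_eq_succ_of_ne_zero fun h0 => hil ?_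
          have hi : i = 0 := Fin.ext (by rw [Fin.val_zero]; omega)
          have hl : l = 0 := Fin.ext (by rw [Fin.val_zero]; omega)
          rw [hi, hl]
        simp only [hankelMatrix, Matrix.of_apply]
        rw [hm, haL])
    have h00 : hankelMatrix L (n + 2) 0 0 = z := by simp [hankelMatrix, hz']
    rw [h00, hsub] at h
    have hPn := hP n
    simp only [Matrix.of_apply, Fin.val_zero, add_zero, ha0] at h
    rw [h] at hPn
    have := (hQpos n).ne'
    field_simp
    linarith
  have hmin : ∀ n : ℕ, ∃ p : Polynomial ℝ, p.natDegree < n + 2 ∧ p.coeff 0 = 1 ∧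
      L (p * p) = z - P n / Q n ∧
      ∀ q : Polynomial ℝ, q.natDegree < n + 2 → q.coeff 0 = 1 → L (p * p) ≤ L (q * q) := by
    intro n
    have h := exists_isMin_hankelMatrix_det_div hL (n + 1)
    rwa [hsub, hdet] at h
  have hlt : ∀ n : ℕ, P n / Q n < z := by
    intro n
    obtain ⟨p, -, hp0, hp, -⟩ := hmin n
    have := hL p (by rintro rfl; simp at hp0)
    linarith
  refine ⟨hQpos, fun n => ⟨?_, hlt n⟩, fun n => ?_, ?_⟩
  · obtain ⟨p, -, -, hp, hpmin⟩ := hmin n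
    have h := hpmin (1 - Polynomial.X) (by
      have := Polynomial.natDegree_sub_le (1 : Polynomial ℝ) Polynomial.X
      simp at this
      omega) (by simp)
    have hexp : (1 - Polynomial.X : Polynomial ℝ) * (1 - Polynomial.X) =
        1 - (Polynomial.X ^ (0 + 1) + Polynomial.X ^ (0 + 1)) + Polynomial.X ^ (1 + 1) := by ring
    have ha1 : a 1 = 1 := by rw [ha 1 le_rfl]; simp
    have ha2 : a 2 < 2 := by
      rw [ha 2 (by norm_num), Finset.sum_range_succ, Finset.sum_range_one]
      have : (0 : ℝ) < (2 ^ (j + 1))⁻¹ := by positivity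
      norm_num [neg_div]
      linarith
    rw [hexp, map_add, map_sub, map_add, haL, haL, hz', hp] at h
    norm_num [ha1] at h
    linarith
  · obtain ⟨p, hpd, hp0, hp, -⟩ := hmin n
    obtain ⟨q, -, -, hq, hqmin⟩ := hmin (n + 1)
    have := hqmin p (by omega) hp0
    linarith
  · have ht := (Filter.tendsto_add_atTop_iff_nat 1).2 (tendsto_zetaFunctional_one_sub_X_pow hj)
    have h0 : Tendsto (fun n => z - P n / Q n) atTop (nhds 0) := by
      refine squeeze_zero (fun n => sub_nonneg.2 (hlt n).le) (fun n => ?_) ht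
      obtain ⟨p, -, -, hp, hpmin⟩ := hmin n
      rw [← hp]
      refine hpmin _ ?_ (by simp [Polynomial.coeff_zero_eq_eval_zero])
      have h1 := Polynomial.natDegree_sub_le (1 : Polynomial ℝ) Polynomial.X
      have h2 := Polynomial.natDegree_pow_le (p := (1 - Polynomial.X : Polynomial ℝ)) (n := n + 1)
      simp only [Polynomial.natDegree_one, Polynomial.natDegree_X] at h1
      have h3 : (n + 1) * (1 - Polynomial.X : Polynomial ℝ).natDegree ≤ (n + 1) * 1 :=
        Nat.mul_le_mul_left _ (by simpa using h1)
      omega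
    simpa using h0.const_sub z
end

section
/- The Lebesgue integral ∫_0^∞ (log x)·e^{-x} dx equals −γ, where γ is the Euler–Mascheroni constant. -/
open MeasureTheory Set Real

theorem Complex.hasDerivAt_Gamma_of_re_pos {s : ℂ} (hs : 0 < s.re) :
    HasDerivAt Complex.Gamma
      (∫ t : ℝ in Ioi 0, (t : ℂ) ^ (s - 1) * (Real.log t * Real.exp (-t))) s := by
  refine (Complex.hasDerivAt_GammaIntegral hs).congr_of_eventuallyEq ?_
  filter_upwards [(isOpen_lt continuous_const Complex.continuous_re).mem_nhds hs] with z hz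
  exact Complex.Gamma_eq_integral hz

/-- The Lebesgue integral `∫_0^∞ (log x) e^{-x} dx` equals `−γ`, where `γ` is the
Euler–Mascheroni constant. -/
theorem stmt_16 :
    ∫ x in Ioi (0 : ℝ), Real.log x * Real.exp (-x) = -Real.eulerMascheroniConstant := by
  have h := (Complex.hasDerivAt_Gamma_of_re_pos (s := 1) (by simp)).unique
    Complex.hasDerivAt_Gamma_one
  simp only [sub_self, Complex.cpow_zero, one_mul, ← Complex.ofReal_mul] at h
  rw [integral_complex_ofReal] at h
  exact_mod_cast h
end
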